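/- arXiv:2003.10640 — 3 statements merged into one kernel-verified Lean document; each statement's English description precedes it below -/
import Mathlib

section
/- The limit as n → ∞ of (u_n(321))^{1/n} exists and equals 4, where u_n(321) is the number of 321-avoiding permutations of length n that have a unique longest increasing subsequence. -/
/-- `s` is the index set of an increasing subsequence of the word `f`. -/
def IsIncSubseq {n : ℕ} {α : Type*} [Preorder α] (f : Fin n → α) (s : Finset (Fin n)) : Prop :=
  ∀ i ∈ s, ∀ j ∈ s, i < j → f i < f j

/-- `f` has a unique longest increasing subsequence. -/
def HasULIS {n : ℕ} {α : Type*} [Preorder α] (f : Fin n → α) : Prop :=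
  ∃! s : Finset (Fin n), IsIncSubseq f s ∧
    ∀ t : Finset (Fin n), IsIncSubseq f t → t.card ≤ s.card

/-- `p` contains the pattern `q`. -/
def Contains {k n : ℕ} (q : Equiv.Perm (Fin k)) (p : Equiv.Perm (Fin n)) : Prop :=
  ∃ f : Fin k → Fin n, StrictMono f ∧ ∀ a b : Fin k, p (f a) < p (f b) ↔ q a < q b

/-- `p` avoids the pattern `q`. -/
def Avoids {k n : ℕ} (q : Equiv.Perm (Fin k)) (p : Equiv.Perm (Fin n)) : Prop :=
  ¬ Contains q p

def pattern321 : Equiv.Perm (Fin 3) := ⟨![2,1,0], ![2,1,0], by decide, by decide⟩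
def pattern231 : Equiv.Perm (Fin 3) := ⟨![1,2,0], ![2,0,1], by decide, by decide⟩
def pattern132 : Equiv.Perm (Fin 3) := ⟨![0,2,1], ![0,2,1], by decide, by decide⟩
def pattern123 : Equiv.Perm (Fin 3) := Equiv.refl (Fin 3)

/-- the number of `q`-avoiding permutations of length `n` with a unique
longest increasing subsequence. -/
noncomputable def uNum {k : ℕ} (q : Equiv.Perm (Fin k)) (n : ℕ) : ℕ :=
  Nat.card {p : Equiv.Perm (Fin n) // Avoids q p ∧ HasULIS ⇑p}

/-- the number of `q`-avoiding involutions of length `n` with a unique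
longest increasing subsequence. -/
noncomputable def iNum {k : ℕ} (q : Equiv.Perm (Fin k)) (n : ℕ) : ℕ :=
  Nat.card {p : Equiv.Perm (Fin n) // p⁻¹ = p ∧ Avoids q p ∧ HasULIS ⇑p}

/-- A permutation is indecomposable if it cannot be cut into a (nonempty) prefix and
a (nonempty) suffix so that every entry of the prefix is smaller than every entry
of the suffix. -/
def Indecomposable {m : ℕ} (w : Equiv.Perm (Fin m)) : Prop :=
  ¬ ∃ j : ℕ, 1 ≤ j ∧ j < m ∧ ∀ a b : Fin m, (a : ℕ) < j → j ≤ (b : ℕ) → w a < w b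

open Finset in
theorem card_filter_block_add_compl {n : ℕ} (S : Finset (Fin n)) {a b : ℕ} (hb : b ≤ n) :
    #{i ∈ S | a ≤ i.val ∧ i.val < b} + #{i ∈ Sᶜ | a ≤ i.val ∧ i.val < b} = b - a := by
  rw [← card_union_of_disjoint (disjoint_filter_filter disjoint_compl_right), ← filter_union,
    union_compl, ← Nat.card_Ico a b]
  refine card_bij (fun i _ => (i : ℕ)) ?_ ?_ ?_
  · intro i hi
    simpa using hi
  · intro i _ j _ h
    exact Fin.ext h
  · intro v hv
    rw [Finset.mem_Ico] at hv
    exact ⟨⟨v, by omega⟩, by simpa using hv, rfl⟩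

open Finset in
theorem card_filter_lt_of_blocks {n : ℕ} (S : Finset (Fin n)) {x m c b K : ℕ}
    (h₀ : #{i ∈ S | i.val < x} = b)
    (h : ∀ r < K, #{i ∈ S | x + r * m ≤ i.val ∧ i.val < x + (r + 1) * m} = c) :
    ∀ r ≤ K, #{i ∈ S | i.val < x + r * m} = b + r * c := by
  intro r
  induction r with
  | zero => simpa using h₀
  | succ r ih =>
    intro hr
    have hle : r * m ≤ (r + 1) * m := Nat.mul_le_mul_right _ (by omega)
    have : ({i ∈ S | i.val < x + (r + 1) * m} : Finset (Fin n)) =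
        {i ∈ S | i.val < x + r * m} ∪
          {i ∈ S | x + r * m ≤ i.val ∧ i.val < x + (r + 1) * m} := by
      ext i
      simp only [mem_filter, mem_union]
      constructor
      · rintro ⟨hi, h'⟩
        by_cases h'' : (i : ℕ) < x + r * m
        · exact Or.inl ⟨hi, h''⟩
        · exact Or.inr ⟨hi, by omega, h'⟩
      · rintro (⟨hi, h'⟩ | ⟨hi, h', h''⟩)
        · exact ⟨hi, by omega⟩
        · exact ⟨hi, h''⟩
    rw [this, card_union_of_disjoint, ih (by omega), h r (by omega)]
    · ring
    · rw [Finset.disjoint_left]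
      intro i hi hi'
      simp only [mem_filter] at hi hi'
      omega

open Finset in
theorem card_filter_lt_apply_of_strictMonoOn {n : ℕ} {p : Equiv.Perm (Fin n)}
    {A B : Finset (Fin n)} (hAB : ∀ i, p i ∈ B ↔ i ∈ A) (hp : StrictMonoOn p (A : Set (Fin n)))
    {u : Fin n} (hu : u ∈ A) :
    #{v ∈ B | v < p u} = #{i ∈ A | i < u} := by
  symm
  refine card_bij (fun i _ => p i) ?_ ?_ ?_
  · intro i hi
    rw [mem_filter] at hi ⊢
    exact ⟨(hAB i).2 hi.1, hp hi.1 hu hi.2⟩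
  · intro i _ j _ h
    exact p.injective h
  · intro v hv
    rw [mem_filter] at hv
    have hm : p.symm v ∈ A := by rw [← hAB]; simpa using hv.1
    refine ⟨p.symm v, ?_, by simp⟩
    rw [mem_filter]
    refine ⟨hm, ?_⟩
    rw [← hp.lt_iff_lt hm hu]
    simpa using hv.2

open Finset in
theorem exists_perm_strictMonoOn {n : ℕ} (A B : Finset (Fin n)) (h : #A = #B) :
    ∃ p : Equiv.Perm (Fin n), (∀ i, p i ∈ B ↔ i ∈ A) ∧ StrictMonoOn p (A : Set (Fin n)) ∧
      StrictMonoOn p ((Aᶜ : Finset (Fin n)) : Set (Fin n)) := by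
  have hc : #Aᶜ = #Bᶜ := by rw [card_compl, card_compl, h]
  let e : A ≃o B := (A.orderIsoOfFin rfl).symm.trans (B.orderIsoOfFin h.symm)
  let f : (Aᶜ : Finset (Fin n)) ≃o (Bᶜ : Finset (Fin n)) :=
    (Aᶜ.orderIsoOfFin rfl).symm.trans (Bᶜ.orderIsoOfFin hc.symm)
  let f' : {i // i ∉ A} ≃ {i // i ∉ B} :=
    (Equiv.subtypeEquivRight fun i => by simp).trans
      (f.toEquiv.trans (Equiv.subtypeEquivRight fun i => by simp))
  let p : Equiv.Perm (Fin n) := Equiv.subtypeCongr (p := (· ∈ A)) (q := (· ∈ B)) e.toEquiv f'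
  have hpA : ∀ i (hi : i ∈ A), p i = e ⟨i, hi⟩ := by
    intro i hi
    simp [p, Equiv.subtypeCongr, Equiv.sumCompl_symm_apply_of_pos hi]
  have hpA' : ∀ i (hi : i ∈ Aᶜ), p i = f ⟨i, hi⟩ := by
    intro i hi
    have hi' : i ∉ A := by simpa using hi
    simp [p, Equiv.subtypeCongr, Equiv.sumCompl_symm_apply_of_neg hi', f']
    rfl
  refine ⟨p, fun i => ?_, fun i hi j hj hij => ?_, fun i hi j hj hij => ?_⟩
  · by_cases hi : i ∈ A
    · simp [hi, hpA i hi]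
    · have hi' : i ∈ Aᶜ := by simpa using hi
      have := (f ⟨i, hi'⟩).2
      rw [mem_compl] at this
      simp [hi, hpA' i hi', this]
  · rw [hpA i hi, hpA j hj]
    exact e.strictMono hij
  · rw [hpA' i hi, hpA' j hj]
    exact f.strictMono hij

open Finset in
theorem avoids_pattern321_of_strictMonoOn {n : ℕ} {p : Equiv.Perm (Fin n)} {A : Finset (Fin n)}
    (hp : StrictMonoOn p (A : Set (Fin n)))
    (hp' : StrictMonoOn p ((Aᶜ : Finset (Fin n)) : Set (Fin n))) :
    Avoids pattern321 p := by
  rintro ⟨f, hf, h⟩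
  have desc : ∀ a b, a < b → pattern321 b < pattern321 a := by decide
  have key : ∀ a b, a < b → ¬ (f a ∈ A ↔ f b ∈ A) := by
    intro a b hab hiff
    have h1 := (h b a).2 (desc a b hab)
    by_cases ha : f a ∈ A
    · exact lt_asymm h1 (hp ha (hiff.1 ha) (hf hab))
    · exact lt_asymm h1 (hp' (by simpa using ha)
        (by simpa using fun hb => ha (hiff.2 hb)) (hf hab))
  have h01 := key 0 1 (by decide)
  have h12 := key 1 2 (by decide)
  have h02 := key 0 2 (by decide)
  tauto

open Finset in
theorem card_lt_card_of_isIncSubseq_of_blocks {n s c d K : ℕ} (hn : n = s + K * (c + d))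
    (hs : c + (c + d) ≤ s) (hdc : d < c) {A B : Finset (Fin n)} {p : Equiv.Perm (Fin n)}
    (hAB : ∀ i, p i ∈ B ↔ i ∈ A) (hp : StrictMonoOn p (A : Set (Fin n)))
    (hp' : StrictMonoOn p ((Aᶜ : Finset (Fin n)) : Set (Fin n)))
    (hA₀ : ∀ i : Fin n, (i : ℕ) < s → i ∈ A)
    (hA : ∀ r < K, #{i ∈ A | s + r * (c + d) ≤ i.val ∧ i.val < s + (r + 1) * (c + d)} = c)
    (hB₀ : ∀ v : Fin n, K * (c + d) ≤ (v : ℕ) → v ∈ B)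
    (hB : ∀ r < K, #{v ∈ B | 0 + r * (c + d) ≤ v.val ∧ v.val < 0 + (r + 1) * (c + d)} = c)
    {T : Finset (Fin n)} (hT : IsIncSubseq p T) (hTA : T ≠ A) : #T < #A := by
  by_cases hsub : T ⊆ A
  · exact card_lt_card (hsub.ssubset_of_ne hTA)
  have hAB' : ∀ i, p i ∈ Bᶜ ↔ i ∈ Aᶜ := by simpa using fun i => not_congr (hAB i)
  have hle : ∀ r < K, (r + 1) * (c + d) ≤ K * (c + d) := fun r hr => Nat.mul_le_mul_right _ hr
  have hA' : ∀ r < K,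
      #{i ∈ Aᶜ | s + r * (c + d) ≤ i.val ∧ i.val < s + (r + 1) * (c + d)} = d := by
    intro r hr
    have h1 := card_filter_block_add_compl A (a := s + r * (c + d)) (b := s + (r + 1) * (c + d))
      (by have := hle r hr; omega)
    rw [hA r hr] at h1
    have : (r + 1) * (c + d) = r * (c + d) + (c + d) := by ring
    omega
  have hB' : ∀ r < K,
      #{v ∈ Bᶜ | 0 + r * (c + d) ≤ v.val ∧ v.val < 0 + (r + 1) * (c + d)} = d := by
    intro r hr
    have h1 := card_filter_block_add_compl B (a := 0 + r * (c + d)) (b := 0 + (r + 1) * (c + d))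
      (by have := hle r hr; omega)
    rw [hB r hr] at h1
    have : (r + 1) * (c + d) = r * (c + d) + (c + d) := by ring
    omega
  have hA'init : #{i ∈ Aᶜ | i.val < s} = 0 := by
    rw [card_eq_zero, filter_eq_empty_iff]
    intro i hi h
    exact (mem_compl.1 hi) (hA₀ i h)
  have hAinit : #{i ∈ A | i.val < s} = s := by
    have := card_filter_block_add_compl A (a := 0) (b := s) (by omega)
    simp only [Nat.zero_le, true_and] at this
    omega
  have cA := card_filter_lt_of_blocks A hAinit hA
  have cA' := card_filter_lt_of_blocks Aᶜ hA'init hA'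
  have cB := card_filter_lt_of_blocks B (x := 0) (b := 0) (by simp) hB
  have cB' := card_filter_lt_of_blocks Bᶜ (x := 0) (b := 0) (by simp) hB'
  simp only [zero_add] at cB cB' cA' hB hB'
  have hm : 0 < c + d := by omega
  let blk : Fin n → ℕ := fun l => (l - s) / (c + d)
  have hblk : ∀ l ∈ Aᶜ, s + blk l * (c + d) ≤ (l : ℕ) ∧ (l : ℕ) < s + (blk l + 1) * (c + d) ∧
      blk l < K := by
    intro l hl
    have h1 : s ≤ (l : ℕ) := by
      by_contra h
      exact mem_compl.1 hl (hA₀ l (by omega))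
    have h2 := Nat.div_mul_le_self (l - s) (c + d)
    have h3 := Nat.lt_div_mul_add (a := l - s) hm
    have h4 : (blk l + 1) * (c + d) = blk l * (c + d) + (c + d) := by ring
    refine ⟨by simp only [blk]; omega, by rw [h4]; simp only [blk]; omega, ?_⟩
    rw [Nat.div_lt_iff_lt_mul hm]
    have := l.2
    omega
  have hval : ∀ l ∈ Aᶜ, (p l : ℕ) < (blk l + 1) * (c + d) := by
    intro l hl
    obtain ⟨h1, h2, h3⟩ := hblk l hl
    by_contra! h
    have e := card_filter_lt_apply_of_strictMonoOn hAB' hp' hl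
    have a1 : #{v ∈ Bᶜ | v.val < (blk l + 1) * (c + d)} ≤ #{v ∈ Bᶜ | v < p l} := by
      apply card_le_card
      apply monotone_filter_right
      intro v _ hv
      exact Fin.lt_def.2 (lt_of_lt_of_le hv h)
    have a2 : #{i ∈ Aᶜ | i < l} < #{i ∈ Aᶜ | i.val < s + (blk l + 1) * (c + d)} := by
      apply card_lt_card
      rw [Finset.ssubset_iff_of_subset]
      · exact ⟨l, by simp [h2]; simpa using hl, by simp⟩
      · apply monotone_filter_right
        intro v _ hv
        exact lt_trans (Fin.lt_def.1 hv) h2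
    rw [cA' _ h3] at a2
    rw [cB' _ h3] at a1
    omega
  let R := (T \ A).image blk
  have hRK : ∀ r ∈ R, ∃ l ∈ T, l ∈ Aᶜ ∧ blk l = r ∧ r < K := by
    intro r hr
    simp only [R, mem_image, mem_sdiff] at hr
    obtain ⟨l, ⟨hl, hl'⟩, rfl⟩ := hr
    exact ⟨l, hl, by simpa using hl', rfl, (hblk l (by simpa using hl')).2.2⟩
  have hX : #(T \ A) ≤ d * #R := by
    refine card_le_mul_card_image _ _ fun r hr => ?_
    obtain ⟨_, -, -, -, hrK⟩ := hRK r hr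
    rw [← hA' r hrK]
    apply card_le_card
    intro l hl
    simp only [mem_filter, mem_sdiff] at hl
    have hl' : l ∈ Aᶜ := by simpa using hl.1.2
    have := hblk l hl'
    rw [hl.2] at this
    exact mem_filter.2 ⟨hl', this.1, this.2.1⟩
  let G : Finset (Fin n) := {u ∈ A | c + d ≤ (p u : ℕ) ∧ (p u : ℕ) / (c + d) - 1 ∈ R}
  have hGT : G ⊆ A \ T := by
    intro u hu
    simp only [G, mem_filter] at hu
    obtain ⟨huA, hum, hur⟩ := hu
    refine mem_sdiff.2 ⟨huA, fun huT => ?_⟩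
    obtain ⟨l, hlT, hlA, hlr, hrK⟩ := hRK _ hur
    set r := (p u : ℕ) / (c + d) - 1 with hr
    have hr1 : (p u : ℕ) / (c + d) = r + 1 := by
      have := Nat.div_pos hum hm
      omega
    have h2 := Nat.div_mul_le_self (p u : ℕ) (c + d)
    have h3 := Nat.lt_div_mul_add (a := (p u : ℕ)) hm
    rw [hr1] at h2 h3
    have hv := hval l hlA
    rw [hlr] at hv
    have hpl : p l < p u := Fin.lt_def.2 (by omega)
    have hul : u < l := by
      by_contra! h
      have e := card_filter_lt_apply_of_strictMonoOn hAB hp huA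
      have b1 : #{i ∈ A | i.val < s + r * (c + d)} ≤ #{i ∈ A | i < u} := by
        apply card_le_card
        apply monotone_filter_right
        intro v _ hv
        have := (hblk l hlA).1
        rw [hlr] at this
        exact Fin.lt_def.2 (lt_of_lt_of_le hv (this.trans h))
      rw [cA r hrK.le] at b1
      have b2 : #{v ∈ B | v < p u} <
          #{v ∈ B | v.val < (r + 1) * (c + d)} + (c + d) := by
        have hle' := hle r hrK
        have hb := card_filter_block_add_compl B (a := (r + 1) * (c + d))
          (b := (r + 1) * (c + d) + (c + d)) (by omega)
        refine lt_of_lt_of_le (b := #({v ∈ B | v.val < (r + 1) * (c + d)} ∪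
          {v ∈ B | (r + 1) * (c + d) ≤ v.val ∧ v.val < (r + 1) * (c + d) + (c + d)})) ?_
          ((card_union_le _ _).trans (by omega))
        apply card_lt_card
        rw [Finset.ssubset_iff_of_subset]
        · refine ⟨p u, mem_union_right _ (mem_filter.2 ⟨(hAB u).2 huA, h2, h3⟩), by simp⟩
        · intro v hv
          rw [mem_filter] at hv
          have := Fin.lt_def.1 hv.2
          by_cases h' : (v : ℕ) < (r + 1) * (c + d)
          · exact mem_union_left _ (mem_filter.2 ⟨hv.1, h'⟩)
          · exact mem_union_right _ (mem_filter.2 ⟨hv.1, by omega, by omega⟩)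
      rw [cB (r + 1) hrK] at b2
      have : (r + 1) * c = r * c + c := by ring
      omega
    exact lt_asymm hpl (hT u huT l hlT hul)
  have hG : c * #R ≤ #G := by
    refine mul_card_image_le_card_of_maps_to (f := fun u => (p u : ℕ) / (c + d) - 1)
      (fun u hu => (mem_filter.1 hu).2.2) c fun r hr => ?_
    obtain ⟨_, -, -, -, hrK⟩ := hRK r hr
    have hblock : c ≤ #{v ∈ B | (r + 1) * (c + d) ≤ v.val ∧ v.val < (r + 1 + 1) * (c + d)} := by
      rcases Nat.lt_or_ge (r + 1) K with h | h
      · exact (hB _ h).ge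
      · have hrK' : r + 1 = K := by omega
        have e : (r + 1 + 1) * (c + d) = (r + 1) * (c + d) + (c + d) := by ring
        have hb := card_filter_block_add_compl B (a := (r + 1) * (c + d))
          (b := (r + 1 + 1) * (c + d)) (by rw [e, hrK']; omega)
        have : #{v ∈ Bᶜ | (r + 1) * (c + d) ≤ v.val ∧
            v.val < (r + 1 + 1) * (c + d)} = 0 := by
          rw [card_eq_zero, filter_eq_empty_iff]
          intro v hv h'
          exact (mem_compl.1 hv) (hB₀ v (by rw [← hrK']; exact h'.1))
        omega
    refine hblock.trans (card_le_card_of_injOn p.symm ?_ p.symm.injective.injOn)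
    intro v hv
    simp only [coe_filter, Set.mem_ofPred_eq] at hv
    obtain ⟨hvB, h1, h2⟩ := hv
    have hdiv : (v : ℕ) / (c + d) = r + 1 :=
      Nat.div_eq_of_lt_le h1 h2
    have hvA : p.symm v ∈ A := by rw [← hAB]; simpa using hvB
    have : c + d ≤ (r + 1) * (c + d) := Nat.le_mul_of_pos_left _ (by omega)
    simp only [G, coe_filter, mem_filter, Set.mem_ofPred_eq, Equiv.apply_symm_apply, hdiv,
      Nat.add_sub_cancel]
    exact ⟨⟨hvA, by omega, hr⟩, trivial⟩
  have hRpos : 0 < #R := by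
    rw [card_pos]
    exact (sdiff_nonempty.2 hsub).image _
  have h1 := card_le_card hGT
  have h2 := card_sdiff_add_card_inter A T
  have h3 := card_sdiff_add_card_inter T A
  rw [inter_comm] at h3
  have h4 : d * #R < c * #R := Nat.mul_lt_mul_of_pos_right hdc hRpos
  omega

/-- The subset of `Fin n` whose `r`-th block of length `m` after position `x` is `W r`, and which
contains everything outside these blocks. -/
def blockSet (n x m : ℕ) {K : ℕ} (W : Fin K → Finset ℕ) : Finset (Fin n) :=
  {i | x ≤ (i : ℕ) → ∀ h : (i - x) / m < K, (i - x) % m ∈ W ⟨(i - x) / m, h⟩}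

theorem mem_blockSet_iff {n x m K : ℕ} (W : Fin K → Finset ℕ) (r : Fin K) {j : ℕ} (hj : j < m)
    {i : Fin n} (hi : (i : ℕ) = x + r * m + j) : i ∈ blockSet n x m W ↔ j ∈ W r := by
  have e : (i : ℕ) - x = j + m * r := by rw [hi, mul_comm]; omega
  have hd : ((i : ℕ) - x) / m = r := by
    rw [e, Nat.add_mul_div_left _ _ (by omega), Nat.div_eq_of_lt hj, zero_add]
  have hmod : ((i : ℕ) - x) % m = j := by
    rw [e, Nat.add_mul_mod_self_left, Nat.mod_eq_of_lt hj]
  have hx : x ≤ (i : ℕ) := by omega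
  simp [blockSet, hd, hmod, hx]

open Finset in
theorem card_filter_blockSet {n x m c K : ℕ} {W : Fin K → Finset ℕ}
    (hn : x + K * m ≤ n) (hW : ∀ r, W r ∈ powersetCard c (range m)) :
    ∀ r < K, #{i ∈ blockSet n x m W | x + r * m ≤ i.val ∧ i.val < x + (r + 1) * m} = c := by
  intro r hr
  obtain ⟨hsub, hcard⟩ := mem_powersetCard.1 (hW ⟨r, hr⟩)
  have hle : (r + 1) * m ≤ K * m := Nat.mul_le_mul_right _ hr
  have e : (r + 1) * m = r * m + m := by ring
  rw [← hcard]
  symm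
  refine card_bij (fun j hj => ⟨x + r * m + j, by have := mem_range.1 (hsub hj); omega⟩) ?_ ?_ ?_
  · intro j hj
    have hjm := mem_range.1 (hsub hj)
    refine mem_filter.2 ⟨(mem_blockSet_iff W ⟨r, hr⟩ hjm rfl).2 hj, ?_, ?_⟩ <;> simp only <;> omega
  · intro j _ j' _ h
    simpa using h
  · intro i hi
    obtain ⟨hi, h1, h2⟩ := mem_filter.1 hi
    have := (mem_blockSet_iff W ⟨r, hr⟩ (x := x) (m := m) (i := i) (j := i - (x + r * m))
      (by omega) (by simp only; omega)).1 hi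
    exact ⟨_, this, Fin.ext (by simp only; omega)⟩

open Finset in
theorem blockSet_injective {n x m c K : ℕ} (hn : x + K * m ≤ n) {W W' : Fin K → Finset ℕ}
    (hW : ∀ r, W r ∈ powersetCard c (range m)) (hW' : ∀ r, W' r ∈ powersetCard c (range m))
    (h : blockSet n x m W = blockSet n x m W') : W = W' := by
  funext r
  ext j
  have hle : ((r : ℕ) + 1) * m ≤ K * m := Nat.mul_le_mul_right _ r.2
  have e : ((r : ℕ) + 1) * m = r * m + m := by ring
  by_cases hj : j < m
  · have hlt : x + r * m + j < n := by omega
    rw [← mem_blockSet_iff W r hj (i := ⟨_, hlt⟩) rfl,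
      ← mem_blockSet_iff W' r hj (i := ⟨_, hlt⟩) rfl, h]
  · have h1 : j ∉ W r := fun h => hj (mem_range.1 ((mem_powersetCard.1 (hW r)).1 h))
    have h2 : j ∉ W' r := fun h => hj (mem_range.1 ((mem_powersetCard.1 (hW' r)).1 h))
    simp [h1, h2]

open Finset in
theorem exists_perm_of_blocks {n s c d K : ℕ} (hn : n = s + K * (c + d))
    (hs : c + (c + d) ≤ s) (hdc : d < c) {W V : Fin K → Finset ℕ}
    (hW : ∀ r, W r ∈ powersetCard c (range (c + d)))
    (hV : ∀ r, V r ∈ powersetCard c (range (c + d))) :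
    ∃ p : Equiv.Perm (Fin n), Avoids pattern321 p ∧
      (∀ i, p i ∈ blockSet n 0 (c + d) V ↔ i ∈ blockSet n s (c + d) W) ∧
      IsIncSubseq p (blockSet n s (c + d) W) ∧
      ∀ T, IsIncSubseq p T → T ≠ blockSet n s (c + d) W → #T < #(blockSet n s (c + d) W) := by
  set A := blockSet n s (c + d) W with hAdef
  set B := blockSet n 0 (c + d) V with hBdef
  have hm : 0 < c + d := by omega
  have hA := card_filter_blockSet (n := n) (x := s) (by omega) hW
  have hB := card_filter_blockSet (n := n) (x := 0) (by omega) hV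
  have hA₀ : ∀ i : Fin n, (i : ℕ) < s → i ∈ A := by
    intro i hi
    simp only [hAdef, blockSet, mem_filter, mem_univ, true_and]
    omega
  have hB₀ : ∀ v : Fin n, K * (c + d) ≤ (v : ℕ) → v ∈ B := by
    intro v hv
    simp only [hBdef, blockSet, mem_filter, mem_univ, true_and]
    intro _ h
    rw [Nat.div_lt_iff_lt_mul hm] at h
    omega
  have hAcard : #A = s + K * c := by
    have h0 := card_filter_block_add_compl A (a := 0) (b := s) (by omega)
    have h1 : #{i ∈ Aᶜ | 0 ≤ i.val ∧ i.val < s} = 0 := by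
      rw [card_eq_zero, filter_eq_empty_iff]
      intro i hi h
      exact (mem_compl.1 hi) (hA₀ i h.2)
    rw [h1] at h0
    simp only [Nat.zero_le, true_and] at h0
    have h2 := card_filter_lt_of_blocks A h0 hA K le_rfl
    rw [filter_true_of_mem (fun i _ => by have := i.2; omega)] at h2
    omega
  have hBcard : #B = s + K * c := by
    have h2 := card_filter_lt_of_blocks B (x := 0) (b := 0) (by simp) hB K le_rfl
    have h0 := card_filter_block_add_compl B (a := K * (c + d)) (b := n) le_rfl
    have h1 : #{i ∈ Bᶜ | K * (c + d) ≤ i.val ∧ i.val < n} = 0 := by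
      rw [card_eq_zero, filter_eq_empty_iff]
      intro i hi h
      exact (mem_compl.1 hi) (hB₀ i h.1)
    have h3 := card_filter_add_card_filter_not (s := B) (fun i => (i : ℕ) < 0 + K * (c + d))
    have h4 : #{i ∈ B | ¬ i.val < 0 + K * (c + d)} =
        #{i ∈ B | K * (c + d) ≤ i.val ∧ i.val < n} := by
      congr 1
      apply filter_congr
      intro i _
      have := i.2
      omega
    omega
  obtain ⟨p, hAB, hp, hp'⟩ := exists_perm_strictMonoOn A B (hAcard.trans hBcard.symm)
  refine ⟨p, avoids_pattern321_of_strictMonoOn hp hp', hAB, fun i hi j hj hij => hp hi hj hij, ?_⟩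
  intro T hT hTA
  exact card_lt_card_of_isIncSubseq_of_blocks hn hs hdc hAB hp hp' hA₀ hA hB₀ hB hT hTA

open Finset in
theorem choose_pow_le_uNum {n s c d K : ℕ} (hn : n = s + K * (c + d))
    (hs : c + (c + d) ≤ s) (hdc : d < c) :
    (c + d).choose c ^ (2 * K) ≤ uNum pattern321 n := by
  let P := Fin K → powersetCard c (range (c + d))
  have key : ∀ w : P × P, ∃ p : Equiv.Perm (Fin n), Avoids pattern321 p ∧
      (∀ i, p i ∈ blockSet n 0 (c + d) (fun r => (w.2 r).1) ↔
        i ∈ blockSet n s (c + d) (fun r => (w.1 r).1)) ∧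
      IsIncSubseq p (blockSet n s (c + d) (fun r => (w.1 r).1)) ∧
      ∀ T, IsIncSubseq p T → T ≠ blockSet n s (c + d) (fun r => (w.1 r).1) →
        #T < #(blockSet n s (c + d) (fun r => (w.1 r).1)) := fun w =>
    exists_perm_of_blocks hn hs hdc (fun r => (w.1 r).2) (fun r => (w.2 r).2)
  choose p hav hAB hinc hmax using key
  have hcard : Nat.card (P × P) = (c + d).choose c ^ (2 * K) := by
    rw [Nat.card_prod, Nat.card_fun]
    simp only [Nat.card_eq_fintype_card, Fintype.card_coe, card_powersetCard, card_range,
      Fintype.card_fin]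
    ring
  rw [← hcard, uNum]
  have hulis : ∀ w, HasULIS (p w) := by
    intro w
    refine ⟨_, ⟨hinc w, fun T hT => ?_⟩, fun T hT => ?_⟩
    · by_cases h : T = blockSet n s (c + d) (fun r => (w.1 r).1)
      · rw [h]
      · exact (hmax w T hT h).le
    · by_contra h
      exact absurd (hT.2 _ (hinc w)) (not_le.2 (hmax w T hT.1 h))
  refine Nat.card_le_card_of_injective (fun w => ⟨p w, hav w, hulis w⟩) ?_
  intro w w' h
  have hpp : p w = p w' := congrArg Subtype.val h
  have hA : blockSet n s (c + d) (fun r => (w.1 r).1) =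
      blockSet n s (c + d) (fun r => (w'.1 r).1) := by
    by_contra hne
    have h1 := hmax w _ (hpp ▸ hinc w') (Ne.symm hne)
    have h2 := hmax w' _ (hpp ▸ hinc w) hne
    omega
  have hB : blockSet n 0 (c + d) (fun r => (w.2 r).1) =
      blockSet n 0 (c + d) (fun r => (w'.2 r).1) := by
    ext v
    have h1 := hAB w ((p w).symm v)
    have h2 := hAB w' ((p w).symm v)
    rw [← hpp] at h2
    rw [Equiv.apply_symm_apply] at h1 h2
    rw [h1, h2, hA]
  have e1 := blockSet_injective (by omega) (fun r => (w.1 r).2) (fun r => (w'.1 r).2) hA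
  have e2 := blockSet_injective (by omega) (fun r => (w.2 r).2) (fun r => (w'.2 r).2) hB
  refine Prod.ext ?_ ?_
  · funext r
    exact Subtype.ext (congrFun e1 r)
  · funext r
    exact Subtype.ext (congrFun e2 r)

/-- The set of positions of the left-to-right maxima of `p`. -/
def leftToRightMaxima {n : ℕ} (p : Equiv.Perm (Fin n)) : Finset (Fin n) :=
  {i | ∀ j < i, p j < p i}

theorem strictMonoOn_leftToRightMaxima {n : ℕ} (p : Equiv.Perm (Fin n)) :
    StrictMonoOn p (leftToRightMaxima p : Set (Fin n)) := by
  intro i _ j hj hij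
  simp only [leftToRightMaxima, Finset.coe_filter, Finset.mem_univ, true_and,
    Set.mem_ofPred_eq] at hj
  exact hj i hij

theorem strictMonoOn_compl_leftToRightMaxima {n : ℕ} {p : Equiv.Perm (Fin n)}
    (hp : Avoids pattern321 p) :
    StrictMonoOn p ((leftToRightMaxima p : Set (Fin n))ᶜ) := by
  intro i hi j _ hij
  simp only [leftToRightMaxima, Finset.coe_filter, Finset.mem_univ, true_and,
    Set.mem_compl_iff, Set.mem_ofPred_eq, not_forall, not_lt] at hi
  obtain ⟨k, hki, hk⟩ := hi
  have hk : p i < p k := lt_of_le_of_ne hk fun h => hki.ne' (p.injective h)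
  by_contra! h
  have h : p j < p i := lt_of_le_of_ne h fun h => hij.ne' (p.injective h)
  refine hp ⟨![k, i, j], ?_, ?_⟩
  · rw [Fin.strictMono_iff_lt_succ]
    intro a
    fin_cases a <;> simpa
  · intro a b
    fin_cases a <;> fin_cases b <;>
      simp [pattern321, h, hk, h.le, hk.le, h.trans hk, (h.trans hk).le]

theorem eqOn_of_strictMonoOn_of_image_eq {α β : Type*} [LinearOrder α] [WellFoundedLT α]
    [PartialOrder β] {f g : α → β} {S : Set α} (hf : StrictMonoOn f S) (hg : StrictMonoOn g S)
    (h : f '' S = g '' S) : Set.EqOn f g S := by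
  have hr : Set.range (S.domRestrict f) = Set.range (S.domRestrict g) := by
    rw [Set.range_domRestrict, Set.range_domRestrict, h]
  have := (StrictMono.range_inj hf.domRestrict hg.domRestrict).1 hr
  intro x hx
  exact congrFun this ⟨x, hx⟩

theorem uNum_pattern321_le (n : ℕ) : uNum pattern321 n ≤ 4 ^ n := by
  have hcard : Nat.card (Finset (Fin n) × Finset (Fin n)) = 4 ^ n := by
    rw [Nat.card_prod, Nat.card_eq_fintype_card, Fintype.card_finset, Fintype.card_fin,
      ← mul_pow]
    norm_num
  rw [← hcard, uNum]
  refine Nat.card_le_card_of_injective (fun p => (leftToRightMaxima p.1,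
    (leftToRightMaxima p.1).map p.1.toEmbedding)) ?_
  rintro ⟨p, hp, _⟩ ⟨q, hq, _⟩ h
  simp only [Prod.mk.injEq] at h
  obtain ⟨hA, hB⟩ := h
  have hp1 := strictMonoOn_leftToRightMaxima p
  have hq1 := strictMonoOn_leftToRightMaxima q
  have hp2 := strictMonoOn_compl_leftToRightMaxima hp
  have hq2 := strictMonoOn_compl_leftToRightMaxima hq
  rw [← hA] at hq1 hq2 hB
  have him : p '' (leftToRightMaxima p : Set (Fin n)) = q '' (leftToRightMaxima p) := by
    simpa using congrArg (fun S : Finset (Fin n) => (S : Set (Fin n))) hB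
  have him' : p '' (leftToRightMaxima p : Set (Fin n))ᶜ = q '' (leftToRightMaxima p : Set _)ᶜ := by
    rw [Set.image_compl_eq p.bijective, Set.image_compl_eq q.bijective, him]
  have e1 := eqOn_of_strictMonoOn_of_image_eq hp1 hq1 him
  have e2 := eqOn_of_strictMonoOn_of_image_eq hp2 hq2 him'
  apply Subtype.ext
  ext1 i
  by_cases hi : i ∈ (leftToRightMaxima p : Set (Fin n))
  · exact e1 hi
  · exact e2 hi

theorem two_pow_le_mul_choose (d : ℕ) :
    2 ^ (2 * d + 1) ≤ (4 * d + 2) * ((d + 1) + d).choose (d + 1) := by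
  have h1 : d.centralBinom ≤ ((d + 1) + d).choose (d + 1) := by
    rw [Nat.centralBinom_eq_two_mul_choose, show (d + 1) + d = 2 * d + 1 by ring, Nat.choose_succ_succ]
    exact Nat.le_add_right _ _
  have h2 : 4 ^ d ≤ (2 * d + 1) * d.centralBinom := by
    rcases Nat.eq_zero_or_pos d with rfl | hd
    · simp
    · exact (Nat.four_pow_le_two_mul_self_mul_centralBinom d hd).trans
        (Nat.mul_le_mul_right _ (by omega))
  calc 2 ^ (2 * d + 1) = 2 * 4 ^ d := by rw [pow_succ, pow_mul]; norm_num; ring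
    _ ≤ 2 * ((2 * d + 1) * ((d + 1) + d).choose (d + 1)) :=
        Nat.mul_le_mul_left _ (h2.trans (Nat.mul_le_mul_left _ h1))
    _ = _ := by ring

open Filter Topology in
theorem eventually_lt_choose_rpow {a : ℝ} (ha : a < 4) :
    ∀ᶠ d : ℕ in atTop,
      a < ((((d + 1) + d).choose (d + 1) : ℕ) : ℝ) ^ (2 / ((2 * d + 1 : ℕ) : ℝ)) := by
  have hy : Tendsto (fun d : ℕ => 4 * (d : ℝ) + 2) atTop atTop :=
    tendsto_atTop_add_const_right _ _ (tendsto_natCast_atTop_atTop.const_mul_atTop (by norm_num))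
  have hlim : Tendsto (fun d : ℕ => 4 / ((4 * (d : ℝ) + 2) ^ (1 / (4 * (d : ℝ) + 2))) ^ 4)
      atTop (𝓝 4) := by
    have := (tendsto_const_nhds (x := (4 : ℝ))).div ((tendsto_rpow_div.comp hy).pow 4) (by norm_num)
    simpa [Function.comp_def, Pi.div_def] using this
  filter_upwards [hlim.eventually (lt_mem_nhds ha)] with d hd
  refine hd.trans_le ?_
  set y : ℝ := 4 * (d : ℝ) + 2 with hydef
  have hy0 : 0 < y := by positivity
  have hC : (2 : ℝ) ^ (2 * d + 1) / y ≤ (((d + 1) + d).choose (d + 1) : ℕ) := by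
    rw [div_le_iff₀' hy0, hydef]
    exact_mod_cast two_pow_le_mul_choose d
  refine le_trans (le_of_eq ?_) (Real.rpow_le_rpow (by positivity) hC (by positivity))
  rw [Real.div_rpow (by positivity) hy0.le, ← Real.rpow_natCast, ← Real.rpow_natCast,
    ← Real.rpow_mul hy0.le, ← Real.rpow_mul (by norm_num)]
  congr 1
  · rw [mul_div_cancel₀ _ (by positivity)]
    norm_num
  · congr 1
    push_cast
    rw [hydef]
    field_simp
    ring

open Filter Topology in
theorem eventually_lt_rpow_uNum (d : ℕ) {a : ℝ}
    (ha : a < ((((d + 1) + d).choose (d + 1) : ℕ) : ℝ) ^ (2 / ((2 * d + 1 : ℕ) : ℝ))) :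
    ∀ᶠ n : ℕ in atTop, a < (uNum pattern321 n : ℝ) ^ ((n : ℝ)⁻¹) := by
  set C : ℕ := ((d + 1) + d).choose (d + 1) with hC
  have hC1 : (1 : ℝ) ≤ C := by exact_mod_cast Nat.choose_pos (by omega)
  set m : ℕ := 2 * d + 1 with hm
  have hm0 : (0 : ℝ) < m := by positivity
  set D : ℝ := 2 * ((d + 1 : ℝ) + 2 * m) / m with hD
  have hlim : Tendsto (fun n : ℕ => (C : ℝ) ^ (2 / (m : ℝ) - D / n)) atTop
      (𝓝 ((C : ℝ) ^ (2 / (m : ℝ)))) := by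
    have h : Tendsto (fun n : ℕ => 2 / (m : ℝ) - D / n) atTop (𝓝 (2 / (m : ℝ))) := by
      simpa using (tendsto_const_div_atTop_nhds_zero_nat D).const_sub (2 / (m : ℝ))
    exact tendsto_const_nhds.rpow h (Or.inl (by positivity))
  filter_upwards [hlim.eventually (lt_mem_nhds ha), eventually_ge_atTop (d + 1 + m)] with n hn hnm
  refine hn.trans_le ?_
  have hn0 : (0 : ℝ) < n := by
    have : 0 < n := by omega
    exact_mod_cast this
  set K := (n - (d + 1 + m)) / m with hK
  have hKm : K * m ≤ n - (d + 1 + m) := Nat.div_mul_le_self _ _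
  have hKm' : n - (d + 1 + m) < K * m + m := Nat.lt_div_mul_add (by omega)
  have hu : C ^ (2 * K) ≤ uNum pattern321 n := by
    refine choose_pow_le_uNum (n := n) (s := n - K * m) ?_ (by omega) (by omega)
    rw [show d + 1 + d = m by omega]
    omega
  have hu' : (C : ℝ) ^ (2 * K) ≤ uNum pattern321 n := by exact_mod_cast hu
  have hKreal : (n : ℝ) ≤ K * m + m + (d + 1 + m) := by
    have : n ≤ K * m + m + (d + 1 + m) := by omega
    exact_mod_cast this
  calc (C : ℝ) ^ (2 / (m : ℝ) - D / n) ≤ (C : ℝ) ^ (((2 * K : ℕ) : ℝ) * (n : ℝ)⁻¹) := by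
        refine Real.rpow_le_rpow_of_exponent_le hC1 ?_
        rw [← div_eq_mul_inv, le_div_iff₀ hn0, sub_mul, div_mul_cancel₀ _ hn0.ne', hD, div_mul_eq_mul_div,
          ← sub_div, div_le_iff₀ hm0]
        push_cast
        linarith
    _ = ((C : ℝ) ^ (2 * K)) ^ ((n : ℝ)⁻¹) := by
        rw [Real.rpow_mul (by positivity), Real.rpow_natCast]
    _ ≤ _ := Real.rpow_le_rpow (by positivity) hu' (by positivity)

/-- The limit as `n → ∞` of `(u_n(321))^{1/n}` exists and equals `4`. -/
theorem lim_root_u321_eq_four :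
    Filter.Tendsto (fun n : ℕ => (uNum pattern321 n : ℝ) ^ ((n : ℝ)⁻¹))
      Filter.atTop (nhds 4) := by
  refine tendsto_order.2 ⟨fun a ha => ?_, fun a ha => ?_⟩
  · obtain ⟨d, hd⟩ := (eventually_lt_choose_rpow ha).exists
    exact eventually_lt_rpow_uNum d hd
  · filter_upwards [Filter.eventually_gt_atTop 0] with n hn
    refine lt_of_le_of_lt ?_ ha
    have h : (uNum pattern321 n : ℝ) ≤ (4 : ℝ) ^ n := by exact_mod_cast uNum_pattern321_le n
    calc (uNum pattern321 n : ℝ) ^ ((n : ℝ)⁻¹) ≤ ((4 : ℝ) ^ n) ^ ((n : ℝ)⁻¹) :=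
          Real.rpow_le_rpow (by positivity) h (by positivity)
      _ = 4 := Real.pow_rpow_inv_natCast (by norm_num) hn.ne'
end

section
/- The formal power series U(z) = Σ_{n≥0} u_n(321) z^n over the rationals is not a rational function; that is, there do not exist polynomials P, Q ∈ ℚ[z] with Q ≠ 0 such that Q·U = P as formal power series. -/
open Filter Asymptotics in
theorem PowerSeries.isLittleO_coeff_polynomial_mul {R : ℝ} (hR : 0 < R) {U : PowerSeries ℂ}
    (hU : (fun n => PowerSeries.coeff n U) =o[atTop] fun n => R ^ n) (S : Polynomial ℂ) :
    (fun n => PowerSeries.coeff n ((S : PowerSeries ℂ) * U)) =o[atTop] fun n => R ^ n := by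
  induction S using Polynomial.induction_on with
  | C a => simpa using hU.const_mul_left a
  | add p q hp hq => simpa [add_mul] using hp.add hq
  | monomial k a ih =>
    have hshift : (((Polynomial.C a * Polynomial.X ^ (k + 1) : Polynomial ℂ) :
        PowerSeries ℂ) * U) =
        PowerSeries.X * (((Polynomial.C a * Polynomial.X ^ k : Polynomial ℂ) :
          PowerSeries ℂ) * U) := by
      push_cast
      ring
    rw [hshift]
    refine IsLittleO.of_bound fun c hc => ?_
    have hev := ih.bound (mul_pos hc hR)
    rw [eventually_atTop] at hev ⊢
    obtain ⟨N, hN⟩ := hev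
    refine ⟨N + 1, fun n hn => ?_⟩
    obtain ⟨m, rfl⟩ : ∃ m, n = m + 1 := ⟨n - 1, by omega⟩
    rw [PowerSeries.coeff_succ_X_mul]
    refine (hN m (by omega)).trans (le_of_eq ?_)
    simp only [norm_pow, Real.norm_eq_abs, abs_of_pos hR]
    ring

open Filter Asymptotics in
theorem PowerSeries.exists_polynomial_eq_of_X_sub_C_mul_eq {R : ℝ} (hR : 0 < R)
    {T : PowerSeries ℂ} (hT : (fun n => PowerSeries.coeff n T) =o[atTop] fun n => R ^ n)
    {β : ℂ} (hβ : ‖β‖ * R ≤ 1) {P : Polynomial ℂ}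
    (h : ((Polynomial.X - Polynomial.C β : Polynomial ℂ) : PowerSeries ℂ) * T = P) :
    ∃ P' : Polynomial ℂ, T = P' := by
  have hrec : ∀ n, P.natDegree ≤ n →
      PowerSeries.coeff n T = β * PowerSeries.coeff (n + 1) T := by
    intro n hn
    have h1 := congrArg (PowerSeries.coeff (n + 1)) h
    simp only [Polynomial.coe_sub, Polynomial.coe_X, Polynomial.coe_C, sub_mul, map_sub,
      PowerSeries.coeff_succ_X_mul, PowerSeries.coeff_C_mul, Polynomial.coeff_coe] at h1
    rw [Polynomial.coeff_eq_zero_of_natDegree_lt (by omega)] at h1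
    exact sub_eq_zero.mp h1
  have hiter : ∀ n, P.natDegree ≤ n → ∀ k,
      PowerSeries.coeff n T = β ^ k * PowerSeries.coeff (n + k) T := by
    intro n hn k
    induction k with
    | zero => simp
    | succ k ih => rw [ih, hrec (n + k) (by omega)]; ring_nf
  have hzero : ∀ n, P.natDegree ≤ n → PowerSeries.coeff n T = 0 := by
    intro n hn
    have hle : ∀ c : ℝ, 0 < c → ‖PowerSeries.coeff n T‖ ≤ c * R ^ n := by
      intro c hc
      obtain ⟨N, hN⟩ := eventually_atTop.mp (hT.bound hc)
      have h1 := hN (n + N) (by omega)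
      rw [norm_pow, Real.norm_eq_abs, abs_of_pos hR] at h1
      rw [hiter n hn N, norm_mul, norm_pow]
      calc ‖β‖ ^ N * ‖PowerSeries.coeff (n + N) T‖
          ≤ ‖β‖ ^ N * (c * R ^ (n + N)) := by gcongr
        _ = c * R ^ n * (‖β‖ * R) ^ N := by ring
        _ ≤ c * R ^ n * 1 := by
            gcongr
            exact pow_le_one₀ (by positivity) hβ
        _ = c * R ^ n := mul_one _
    have hpos : 0 < R ^ n := by positivity
    by_contra hne
    have hn0 : 0 < ‖PowerSeries.coeff n T‖ := norm_pos_iff.mpr hne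
    have h2 := hle (‖PowerSeries.coeff n T‖ / R ^ n / 2) (by positivity)
    have h3 : ‖PowerSeries.coeff n T‖ / R ^ n / 2 * R ^ n = ‖PowerSeries.coeff n T‖ / 2 := by
      field_simp
    linarith
  refine ⟨PowerSeries.trunc P.natDegree T, PowerSeries.ext fun n => ?_⟩
  rw [Polynomial.coeff_coe, PowerSeries.coeff_trunc]
  split_ifs with hn
  · rfl
  · exact hzero n (by omega)

theorem PowerSeries.exists_geometric_bound_of_X_sub_C_mul {R r C : ℝ} (hr : 0 < r)
    (hrR : r < R) (hC : 0 ≤ C) {U : PowerSeries ℂ} {β : ℂ} (hβ : 1 < ‖β‖ * R)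
    (h : ∀ n, ‖PowerSeries.coeff n
      (((Polynomial.X - Polynomial.C β : Polynomial ℂ) : PowerSeries ℂ) * U)‖ ≤ C * r ^ n) :
    ∃ r' C' : ℝ, 0 < r' ∧ r' < R ∧ 0 ≤ C' ∧ ∀ n, ‖PowerSeries.coeff n U‖ ≤ C' * r' ^ n := by
  have hR : 0 < R := hr.trans hrR
  have hβ0 : 0 < ‖β‖ := by
    by_contra hneg
    have : ‖β‖ = 0 := le_antisymm (not_lt.mp hneg) (norm_nonneg _)
    rw [this] at hβ
    linarith
  have hβR : 1 / ‖β‖ < R := by rwa [div_lt_iff₀ hβ0, mul_comm]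
  obtain ⟨r', h1, h2⟩ := exists_between (max_lt hrR hβR)
  have hrr' : r < r' := (le_max_left _ _).trans_lt h1
  have hβr' : 1 / ‖β‖ < r' := (le_max_right _ _).trans_lt h1
  have hr' : 0 < r' := hr.trans hrr'
  have hδ : 0 < ‖β‖ * r' - 1 := by
    rw [div_lt_iff₀ hβ0, mul_comm] at hβr'
    linarith
  set K := max ‖PowerSeries.coeff 0 U‖ (C * r' / (‖β‖ * r' - 1)) with hK
  have hK0 : 0 ≤ K := (norm_nonneg _).trans (le_max_left _ _)
  have hKδ : C * r' + K ≤ K * (‖β‖ * r') := by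
    have : C * r' / (‖β‖ * r' - 1) ≤ K := le_max_right _ _
    rw [div_le_iff₀ hδ] at this
    linarith
  refine ⟨r', K, hr', h2, hK0, fun n => ?_⟩
  induction n with
  | zero => rw [pow_zero, mul_one]; exact le_max_left _ _
  | succ n ih =>
    have h3 := h (n + 1)
    simp only [Polynomial.coe_sub, Polynomial.coe_X, Polynomial.coe_C, sub_mul, map_sub,
      PowerSeries.coeff_succ_X_mul, PowerSeries.coeff_C_mul] at h3
    have h4 : ‖β‖ * ‖PowerSeries.coeff (n + 1) U‖ ≤
        ‖PowerSeries.coeff n U‖ + C * r ^ (n + 1) := by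
      have := norm_sub_norm_le (β * PowerSeries.coeff (n + 1) U) (PowerSeries.coeff n U)
      rw [norm_sub_rev, norm_mul] at this
      linarith
    have h5 : C * r ^ (n + 1) ≤ C * r' ^ (n + 1) := by gcongr
    have h6 : (C * r' + K) * r' ^ n ≤ K * (‖β‖ * r') * r' ^ n := by gcongr
    refine le_of_mul_le_mul_left ?_ hβ0
    calc ‖β‖ * ‖PowerSeries.coeff (n + 1) U‖ ≤ K * r' ^ n + C * r' ^ (n + 1) := by linarith
      _ = (C * r' + K) * r' ^ n := by ring
      _ ≤ K * (‖β‖ * r') * r' ^ n := h6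
      _ = ‖β‖ * (K * r' ^ (n + 1)) := by ring

theorem Polynomial.exists_geometric_bound_coeff (P : Polynomial ℂ) {r : ℝ} (hr : 0 < r) :
    ∃ C : ℝ, 0 ≤ C ∧ ∀ n, ‖P.coeff n‖ ≤ C * r ^ n := by
  have hterm : ∀ i, 0 ≤ ‖P.coeff i‖ / r ^ i := fun i => by positivity
  refine ⟨∑ i ∈ P.support, ‖P.coeff i‖ / r ^ i, Finset.sum_nonneg fun i _ => hterm i,
    fun n => ?_⟩
  by_cases hn : n ∈ P.support
  · rw [← div_le_iff₀ (by positivity)]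
    exact Finset.single_le_sum (f := fun i => ‖P.coeff i‖ / r ^ i) (fun i _ => hterm i) hn
  · rw [Polynomial.notMem_support_iff.mp hn, norm_zero]
    exact mul_nonneg (Finset.sum_nonneg fun i _ => hterm i) (by positivity)

open Filter Asymptotics in
/-- A rational power series whose coefficients are `o(R ^ n)` has coefficients `O(r ^ n)` for
some `r < R`. -/
theorem PowerSeries.exists_geometric_bound_of_isLittleO {R : ℝ} (hR : 0 < R)
    {U : PowerSeries ℂ} (hU : (fun n => PowerSeries.coeff n U) =o[atTop] fun n => R ^ n)
    {P Q : Polynomial ℂ} (hQ : Q ≠ 0) (h : (Q : PowerSeries ℂ) * U = P) :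
    ∃ r C : ℝ, 0 < r ∧ r < R ∧ 0 ≤ C ∧ ∀ n, ‖PowerSeries.coeff n U‖ ≤ C * r ^ n := by
  obtain ⟨d, hd⟩ : ∃ d, Q.natDegree = d := ⟨_, rfl⟩
  induction d generalizing U P Q with
  | zero =>
    rw [Polynomial.natDegree_eq_zero] at hd
    obtain ⟨c, rfl⟩ := hd
    have hc : c ≠ 0 := by simpa using hQ
    have hUP : U = ((Polynomial.C c⁻¹ * P : Polynomial ℂ) : PowerSeries ℂ) := by
      rw [Polynomial.coe_mul, ← h, Polynomial.coe_C, Polynomial.coe_C, ← mul_assoc, ← map_mul,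
        inv_mul_cancel₀ hc, map_one, one_mul]
    obtain ⟨C, hC, hb⟩ := (Polynomial.C c⁻¹ * P).exists_geometric_bound_coeff (half_pos hR)
    refine ⟨R / 2, C, half_pos hR, half_lt_self hR, hC, fun n => ?_⟩
    rw [hUP, Polynomial.coeff_coe]
    exact hb n
  | succ d ih =>
    have hdeg : 0 < Q.degree := Polynomial.natDegree_pos_iff_degree_pos.mp (by omega)
    obtain ⟨β, hβ⟩ := Complex.exists_root hdeg
    obtain ⟨S, rfl⟩ := Polynomial.dvd_iff_isRoot.mpr hβ
    have hS : S ≠ 0 := right_ne_zero_of_mul hQ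
    have hSd : S.natDegree = d := by
      rw [Polynomial.natDegree_mul (Polynomial.X_sub_C_ne_zero β) hS,
        Polynomial.natDegree_X_sub_C] at hd
      omega
    rw [Polynomial.coe_mul] at h
    by_cases hβR : ‖β‖ * R ≤ 1
    · rw [mul_assoc] at h
      obtain ⟨P', hP'⟩ := PowerSeries.exists_polynomial_eq_of_X_sub_C_mul_eq hR
        (PowerSeries.isLittleO_coeff_polynomial_mul hR hU S) hβR h
      exact ih hU hS hP' hSd
    · rw [mul_comm ((Polynomial.X - Polynomial.C β : Polynomial ℂ) : PowerSeries ℂ),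
        mul_assoc] at h
      obtain ⟨r, C, hr, hrR, hC, hb⟩ :=
        ih (PowerSeries.isLittleO_coeff_polynomial_mul hR hU _) hS h hSd
      exact PowerSeries.exists_geometric_bound_of_X_sub_C_mul hr hrR hC (not_le.mp hβR) hb

theorem Finset.eqOn_of_image_eq_of_strictMonoOn {α β : Type*} [LinearOrder α] [LinearOrder β]
    {s : Finset α} {f g : α → β} (hf : StrictMonoOn f s) (hg : StrictMonoOn g s)
    (h : s.image f = s.image g) : Set.EqOn f g s := by
  have key : ∀ u : α → β, StrictMonoOn u s → s.image u = s.image g →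
      ∀ hc : (s.image g).card = s.card,
      u ∘ s.orderEmbOfFin rfl = (s.image g).orderEmbOfFin hc := by
    intro u hu hug hc
    refine Finset.orderEmbOfFin_unique hc (fun x => ?_) fun x y hxy => ?_
    · rw [← hug]
      exact Finset.mem_image_of_mem u (Finset.orderEmbOfFin_mem s rfl x)
    · exact hu (Finset.orderEmbOfFin_mem s rfl x) (Finset.orderEmbOfFin_mem s rfl y)
        ((s.orderEmbOfFin rfl).strictMono hxy)
  have hc : (s.image g).card = s.card := Finset.card_image_of_injOn hg.injOn
  intro x hx
  have hx' : x ∈ Set.range (s.orderEmbOfFin rfl) := by rwa [Finset.range_orderEmbOfFin]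
  obtain ⟨i, rfl⟩ := hx'
  exact congrFun ((key f hf h hc).trans (key g hg rfl hc).symm) i

theorem Equiv.Perm.eq_of_strictMonoOn_of_image_eq {n : ℕ} {p p' : Equiv.Perm (Fin n)}
    {A : Finset (Fin n)} (hp : StrictMonoOn p A) (hp' : StrictMonoOn p' A)
    (hpc : StrictMonoOn p (Aᶜ : Finset (Fin n))) (hpc' : StrictMonoOn p' (Aᶜ : Finset (Fin n)))
    (h : A.image p = A.image p') : p = p' := by
  have hc : Aᶜ.image p = Aᶜ.image p' := by
    have h' : p '' A = p' '' A := by simpa using congrArg (fun s : Finset (Fin n) => (s : Set (Fin n))) h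
    rw [← Finset.coe_inj]
    push_cast
    rw [Set.image_compl_eq p.bijective, Set.image_compl_eq p'.bijective, h']
  ext1 x
  by_cases hx : x ∈ A
  · exact Finset.eqOn_of_image_eq_of_strictMonoOn hp hp' h hx
  · exact Finset.eqOn_of_image_eq_of_strictMonoOn hpc hpc' hc (by simpa using hx)

/-- The positions of the left-to-right maxima of `p`. -/
def ltrMaxima {n : ℕ} (p : Equiv.Perm (Fin n)) : Finset (Fin n) :=
  Finset.univ.filter fun i => ∀ j < i, p j < p i

theorem strictMonoOn_ltrMaxima {n : ℕ} (p : Equiv.Perm (Fin n)) :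
    StrictMonoOn p (ltrMaxima p) := by
  intro x _ y hy hxy
  exact (Finset.mem_filter.mp hy).2 x hxy

theorem strictMonoOn_compl_ltrMaxima {n : ℕ} {p : Equiv.Perm (Fin n)}
    (hp : Avoids pattern321 p) : StrictMonoOn p ((ltrMaxima p)ᶜ : Finset (Fin n)) := by
  intro x hx y _ hxy
  by_contra hlt
  have hyx : p y < p x := lt_of_le_of_ne (not_lt.mp hlt) (p.injective.ne hxy.ne')
  simp only [ltrMaxima, Finset.coe_compl, Set.mem_compl_iff, Finset.mem_coe, Finset.mem_filter,
    Finset.mem_univ, true_and, not_forall, not_lt] at hx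
  obtain ⟨z, hzx, hxz⟩ := hx
  have hxz' : p x < p z := lt_of_le_of_ne hxz (p.injective.ne hzx.ne')
  refine hp ⟨![z, x, y], ?_, ?_⟩
  · rw [Fin.strictMono_iff_lt_succ]
    intro i
    fin_cases i
    · exact hzx
    · exact hxy
  · intro a b
    fin_cases a <;> fin_cases b <;>
      simp [pattern321, hxz', hyx, hxz'.le, hyx.le, hyx.trans hxz', (hyx.trans hxz').le]

theorem uNum_pattern321_le_centralBinom (n : ℕ) : uNum pattern321 n ≤ n.centralBinom := by
  have hmem : ∀ p : Equiv.Perm (Fin n),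
      (ltrMaxima p).disjSum ((ltrMaxima p).image p)ᶜ ∈
        Finset.powersetCard n (Finset.univ : Finset (Fin n ⊕ Fin n)) := by
    intro p
    have hle : (ltrMaxima p).card ≤ n := by simpa using Finset.card_le_univ (ltrMaxima p)
    rw [Finset.mem_powersetCard, Finset.card_disjSum, Finset.card_compl,
      Finset.card_image_of_injective _ p.injective, Fintype.card_fin]
    exact ⟨Finset.subset_univ _, by omega⟩
  calc uNum pattern321 n
      ≤ Nat.card (Finset.powersetCard n (Finset.univ : Finset (Fin n ⊕ Fin n))) := by
        refine Nat.card_le_card_of_injective (fun p => ⟨_, hmem p.1⟩) fun p p' h => ?_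
        simp only [Subtype.mk.injEq] at h
        have hA : ltrMaxima p.1 = ltrMaxima p'.1 := by
          simpa using congrArg Finset.toLeft h
        have hB : (ltrMaxima p.1).image p.1 = (ltrMaxima p'.1).image p'.1 := by
          simpa using congrArg Finset.toRight h
        refine Subtype.ext (Equiv.Perm.eq_of_strictMonoOn_of_image_eq
          (strictMonoOn_ltrMaxima p.1) ?_ (strictMonoOn_compl_ltrMaxima p.2.1) ?_
          (hB.trans (by rw [hA])))
        · rw [hA]
          exact strictMonoOn_ltrMaxima p'.1
        · rw [hA]
          exact strictMonoOn_compl_ltrMaxima p'.2.1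
    _ = n.centralBinom := by
        rw [Nat.card_eq_fintype_card, Fintype.card_coe, Finset.card_powersetCard,
          Finset.card_univ, Fintype.card_sum, Fintype.card_fin, Nat.centralBinom, two_mul]

theorem Nat.centralBinom_sq_mul_le (n : ℕ) : n.centralBinom ^ 2 * (2 * n + 1) ≤ 16 ^ n := by
  induction n with
  | zero => simp
  | succ n ih =>
    have h := Nat.succ_mul_centralBinom_succ n
    refine Nat.le_of_mul_le_mul_left (c := (n + 1) ^ 2) ?_ (by positivity)
    calc (n + 1) ^ 2 * ((n + 1).centralBinom ^ 2 * (2 * (n + 1) + 1))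
        = ((n + 1) * (n + 1).centralBinom) ^ 2 * (2 * n + 3) := by ring
      _ = n.centralBinom ^ 2 * (2 * n + 1) * (4 * ((2 * n + 1) * (2 * n + 3))) := by
          rw [h]; ring
      _ ≤ 16 ^ n * (4 * ((2 * n + 1) * (2 * n + 3))) := by gcongr
      _ ≤ 16 ^ n * (16 * (n + 1) ^ 2) :=
          Nat.mul_le_mul_left _ (by nlinarith)
      _ = (n + 1) ^ 2 * 16 ^ (n + 1) := by ring

open Filter Asymptotics in
theorem uNum_pattern321_isLittleO :
    (fun n => (uNum pattern321 n : ℂ)) =o[atTop] fun n => (4 : ℝ) ^ n := by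
  refine IsLittleO.of_bound fun c hc => ?_
  obtain ⟨N, hN⟩ := exists_nat_gt (1 / c ^ 2)
  filter_upwards [eventually_ge_atTop N] with n hn
  have h1 : (uNum pattern321 n : ℝ) ≤ n.centralBinom := by
    exact_mod_cast uNum_pattern321_le_centralBinom n
  have h2 : (n.centralBinom : ℝ) ^ 2 * (2 * n + 1) ≤ 16 ^ n := by
    exact_mod_cast Nat.centralBinom_sq_mul_le n
  have h3 : 1 ≤ c ^ 2 * (2 * n + 1) := by
    rw [div_lt_iff₀ (by positivity)] at hN
    have : (N : ℝ) ≤ n := by exact_mod_cast hn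
    nlinarith [sq_nonneg c, mul_le_mul_of_nonneg_right this (sq_nonneg c)]
  rw [Complex.norm_natCast, norm_pow, Real.norm_ofNat]
  refine h1.trans (le_of_sq_le_sq ?_ (by positivity))
  have h4 : (c * 4 ^ n) ^ 2 = c ^ 2 * (16 : ℝ) ^ n := by
    rw [mul_pow, ← pow_mul, mul_comm n, pow_mul]; norm_num
  rw [h4]
  calc (n.centralBinom : ℝ) ^ 2 ≤ n.centralBinom ^ 2 * (c ^ 2 * (2 * n + 1)) :=
        le_mul_of_one_le_right (by positivity) h3
    _ = c ^ 2 * (n.centralBinom ^ 2 * (2 * n + 1)) := by ring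
    _ ≤ c ^ 2 * 16 ^ n := by gcongr

section Shuffle

variable {q n : ℕ} {e e' : Fin (q + 1) ⊕ Fin q ≃ Fin n}

theorem avoids_pattern321_of_strictMono (hl : StrictMono (e ∘ Sum.inl))
    (hr : StrictMono (e ∘ Sum.inr)) (hl' : StrictMono (e' ∘ Sum.inl))
    (hr' : StrictMono (e' ∘ Sum.inr)) : Avoids pattern321 (e.symm.trans e') := by
  have key : ∀ a b, e a < e b → e' b < e' a → a.isLeft ≠ b.isLeft := by
    rintro (a | a) (b | b) hab hba
    · exact absurd (hl' (hl.lt_iff_lt.mp hab)) (not_lt.mpr hba.le)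
    · simp
    · simp
    · exact absurd (hr' (hr.lt_iff_lt.mp hab)) (not_lt.mpr hba.le)
  rintro ⟨f, hf, h⟩
  have hinv : ∀ a b : Fin 3, a < b → pattern321 b < pattern321 a →
      (e.symm (f a)).isLeft ≠ (e.symm (f b)).isLeft := fun a b hab hba =>
    key _ _ (by simpa using hf hab) (by simpa using (h b a).mpr hba)
  have h01 := hinv 0 1 (by decide) (by decide)
  have h12 := hinv 1 2 (by decide) (by decide)
  have h02 := hinv 0 2 (by decide) (by decide)
  revert h01 h12 h02
  generalize (e.symm (f 0)).isLeft = x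
  generalize (e.symm (f 1)).isLeft = y
  generalize (e.symm (f 2)).isLeft = z
  revert x y z
  decide

theorem isIncSubseq_image_inl (hl : StrictMono (e ∘ Sum.inl)) (hl' : StrictMono (e' ∘ Sum.inl)) :
    IsIncSubseq (e.symm.trans e') (Finset.univ.image (e ∘ Sum.inl)) := by
  simp only [IsIncSubseq, Finset.mem_image, Finset.mem_univ, true_and]
  rintro _ ⟨i, rfl⟩ _ ⟨j, rfl⟩ hij
  simpa using hl' (hl.lt_iff_lt.mp hij)

theorem injOn_of_isIncSubseq (hl : StrictMono (e ∘ Sum.inl))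
    (hpos : ∀ t : Fin q, e (Sum.inl t.succ) < e (Sum.inr t))
    (hval : ∀ t : Fin q, e' (Sum.inr t) < e' (Sum.inl t.castSucc))
    {s : Finset (Fin n)} (hs : IsIncSubseq (e.symm.trans e') s) :
    Set.InjOn (fun x => Sum.elim id Fin.castSucc (e.symm x)) s := by
  have key : ∀ t : Fin q, e (Sum.inl t.castSucc) ∈ s → e (Sum.inr t) ∈ s → False := by
    intro t h1 h2
    have hlt := hs _ h1 _ h2 ((hl (Fin.castSucc_lt_succ (i := t))).trans (hpos t))
    simp only [Equiv.trans_apply, Equiv.symm_apply_apply] at hlt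
    exact lt_asymm hlt (hval t)
  intro x hx y hy hxy
  obtain ⟨a, rfl⟩ := e.surjective x
  obtain ⟨b, rfl⟩ := e.surjective y
  simp only [Equiv.symm_apply_apply] at hxy
  rcases a with a | a <;> rcases b with b | b <;> simp only [Sum.elim_inl, Sum.elim_inr, id] at hxy
  · rw [hxy]
  · subst hxy
    exact (key b hx hy).elim
  · subst hxy
    exact (key a hy hx).elim
  · rw [Fin.castSucc_injective _ hxy]

theorem card_le_of_isIncSubseq (hl : StrictMono (e ∘ Sum.inl))
    (hpos : ∀ t : Fin q, e (Sum.inl t.succ) < e (Sum.inr t))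
    (hval : ∀ t : Fin q, e' (Sum.inr t) < e' (Sum.inl t.castSucc))
    {s : Finset (Fin n)} (hs : IsIncSubseq (e.symm.trans e') s) : s.card ≤ q + 1 := by
  rw [← Finset.card_image_of_injOn (injOn_of_isIncSubseq hl hpos hval hs)]
  simpa using Finset.card_le_univ
    (s.image fun x => Sum.elim id Fin.castSucc (e.symm x))

theorem eq_image_inl_of_isIncSubseq (hl : StrictMono (e ∘ Sum.inl))
    (hl' : StrictMono (e' ∘ Sum.inl))
    (hpos : ∀ t : Fin q, e (Sum.inl t.succ) < e (Sum.inr t))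
    (hval : ∀ t : Fin q, e' (Sum.inr t) < e' (Sum.inl t.castSucc))
    {s : Finset (Fin n)} (hs : IsIncSubseq (e.symm.trans e') s) (hcard : s.card = q + 1) :
    s = Finset.univ.image (e ∘ Sum.inl) := by
  have hsurj : ∀ i : Fin (q + 1),
      e (Sum.inl i) ∈ s ∨ ∃ t : Fin q, t.castSucc = i ∧ e (Sum.inr t) ∈ s := by
    intro i
    have huniv : (s.image fun x => Sum.elim id Fin.castSucc (e.symm x)) = Finset.univ := by
      rw [← Finset.card_eq_iff_eq_univ,
        Finset.card_image_of_injOn (injOn_of_isIncSubseq hl hpos hval hs), hcard,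
        Fintype.card_fin]
    obtain ⟨x, hx, rfl⟩ := Finset.mem_image.mp (huniv ▸ Finset.mem_univ i)
    obtain ⟨a, rfl⟩ := e.surjective x
    rcases a with a | a
    · left
      simpa using hx
    · right
      exact ⟨a, by simp, hx⟩
  have hnot : ∀ m : ℕ, ∀ t : Fin q, q - t ≤ m → e (Sum.inr t) ∉ s := by
    intro m
    induction m with
    | zero => intro t ht; omega
    | succ m ih =>
      intro t ht hts
      rcases hsurj t.succ with h | ⟨t', ht', h⟩
      · have hlt := hs _ h _ hts (hpos t)
        simp only [Equiv.trans_apply, Equiv.symm_apply_apply] at hlt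
        exact lt_asymm hlt ((hval t).trans (hl' (Fin.castSucc_lt_succ (i := t))))
      · have hval' : (t' : ℕ) = t + 1 := by simpa using congrArg Fin.val ht'
        exact ih t' (by omega) h
  refine Finset.eq_of_subset_of_card_le (fun x hx => ?_) ?_
  · obtain ⟨a, rfl⟩ := e.surjective x
    rcases a with a | a
    · exact Finset.mem_image_of_mem _ (Finset.mem_univ a)
    · exact absurd hx (hnot q a (by omega))
  · rw [Finset.card_image_of_injective _ hl.injective, hcard, Finset.card_univ, Fintype.card_fin]

theorem hasULIS_of_ballot (hl : StrictMono (e ∘ Sum.inl)) (hl' : StrictMono (e' ∘ Sum.inl))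
    (hpos : ∀ t : Fin q, e (Sum.inl t.succ) < e (Sum.inr t))
    (hval : ∀ t : Fin q, e' (Sum.inr t) < e' (Sum.inl t.castSucc)) :
    HasULIS (e.symm.trans e') := by
  have hcard : (Finset.univ.image (e ∘ Sum.inl)).card = q + 1 := by
    rw [Finset.card_image_of_injective _ hl.injective, Finset.card_univ, Fintype.card_fin]
  refine ⟨Finset.univ.image (e ∘ Sum.inl), ⟨isIncSubseq_image_inl hl hl', fun t ht => ?_⟩, ?_⟩
  · rw [hcard]
    exact card_le_of_isIncSubseq hl hpos hval ht
  · rintro s ⟨hs, hmax⟩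
    refine eq_image_inl_of_isIncSubseq hl hl' hpos hval hs
      (le_antisymm (card_le_of_isIncSubseq hl hpos hval hs) ?_)
    rw [← hcard]
    exact hmax _ (isIncSubseq_image_inl hl hl')

end Shuffle

theorem Finset.card_filter_lt_le_of_le_orderEmbOfFin {α : Type*} [LinearOrder α] {s : Finset α}
    {k : ℕ} (h : s.card = k) {x : α} {j : Fin k} (hx : x ≤ s.orderEmbOfFin h j) :
    (s.filter (· < x)).card ≤ j := by
  have hsub : s.filter (· < x) ⊆ (Finset.Iio j).image (s.orderEmbOfFin h) := by
    intro y hy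
    rw [Finset.mem_filter] at hy
    have hy' : y ∈ Set.range (s.orderEmbOfFin h) := by
      rw [Finset.range_orderEmbOfFin]
      exact hy.1
    obtain ⟨i, rfl⟩ := hy'
    exact Finset.mem_image_of_mem _
      (Finset.mem_Iio.mpr ((s.orderEmbOfFin h).lt_iff_lt.mp (hy.2.trans_le hx)))
  simpa using (Finset.card_le_card hsub).trans Finset.card_image_le

theorem Finset.lt_card_filter_lt_of_orderEmbOfFin_lt {α : Type*} [LinearOrder α] {s : Finset α}
    {k : ℕ} (h : s.card = k) {x : α} {j : Fin k} (hx : s.orderEmbOfFin h j < x) :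
    j < (s.filter (· < x)).card := by
  have hsub : (Finset.Iic j).image (s.orderEmbOfFin h) ⊆ s.filter (· < x) := by
    intro y hy
    obtain ⟨i, hi, rfl⟩ := Finset.mem_image.mp hy
    rw [Finset.mem_filter]
    exact ⟨Finset.orderEmbOfFin_mem s h i,
      ((s.orderEmbOfFin h).monotone (Finset.mem_Iic.mp hi)).trans_lt hx⟩
  have hle := Finset.card_le_card hsub
  rw [Finset.card_image_of_injective _ (s.orderEmbOfFin h).injective, Fin.card_Iic] at hle
  omega

theorem Finset.card_filter_orderEmbOfFin_lt {α : Type*} [LinearOrder α] {s : Finset α}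
    {k : ℕ} (h : s.card = k) (j : Fin k) :
    (s.filter (· < s.orderEmbOfFin h j)).card = j := by
  refine le_antisymm (Finset.card_filter_lt_le_of_le_orderEmbOfFin h le_rfl) ?_
  by_contra! hlt
  have h1 : (s.filter (· < s.orderEmbOfFin h j)).card < k := hlt.trans j.2
  have h2 := Finset.lt_card_filter_lt_of_orderEmbOfFin_lt h
    (x := s.orderEmbOfFin h j) (j := ⟨_, h1⟩) ((s.orderEmbOfFin h).strictMono hlt)
  exact lt_irrefl _ h2

/-- Sets of `q + 1` positions such that the element of index `t` of the complement lies above the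
element of index `t + 1` of the set. -/
def positionSets (q : ℕ) : Finset (Finset (Fin (2 * q + 1))) :=
  Finset.univ.filter fun A => A.card = q + 1 ∧
    ∀ x ∉ A, (Aᶜ.filter (· < x)).card + 2 ≤ (A.filter (· < x)).card

/-- Sets of `q + 1` values such that the element of index `t` of the complement lies below the
element of index `t` of the set. -/
def valueSets (q : ℕ) : Finset (Finset (Fin (2 * q + 1))) :=
  Finset.univ.filter fun B => B.card = q + 1 ∧
    ∀ y ∉ B, (B.filter (· < y)).card ≤ (Bᶜ.filter (· < y)).card

theorem card_compl_of_card_eq {q : ℕ} {A : Finset (Fin (2 * q + 1))} (hA : A.card = q + 1) :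
    Aᶜ.card = q := by
  rw [Finset.card_compl, Fintype.card_fin]
  omega

/-- The permutation mapping `A` increasingly onto `B` and `Aᶜ` increasingly onto `Bᶜ`. -/
def shuffle {q : ℕ} {A B : Finset (Fin (2 * q + 1))} (hA : A.card = q + 1)
    (hB : B.card = q + 1) : Equiv.Perm (Fin (2 * q + 1)) :=
  (finSumEquivOfFinset hA (card_compl_of_card_eq hA)).symm.trans
    (finSumEquivOfFinset hB (card_compl_of_card_eq hB))

theorem strictMono_finSumEquivOfFinset_inl {q : ℕ} {A : Finset (Fin (2 * q + 1))}
    (hA : A.card = q + 1) :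
    StrictMono (finSumEquivOfFinset hA (card_compl_of_card_eq hA) ∘ Sum.inl) := fun i j hij => by
  simpa using hij

theorem strictMono_finSumEquivOfFinset_inr {q : ℕ} {A : Finset (Fin (2 * q + 1))}
    (hA : A.card = q + 1) :
    StrictMono (finSumEquivOfFinset hA (card_compl_of_card_eq hA) ∘ Sum.inr) := fun i j hij => by
  simpa using hij

theorem image_finSumEquivOfFinset_inl {q : ℕ} {A : Finset (Fin (2 * q + 1))}
    (hA : A.card = q + 1) :
    Finset.univ.image (finSumEquivOfFinset hA (card_compl_of_card_eq hA) ∘ Sum.inl) = A := by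
  rw [← Finset.coe_inj]
  simp only [Finset.coe_image, Finset.coe_univ, Set.image_univ]
  rw [← Finset.range_orderEmbOfFin A hA]
  congr 1

theorem image_shuffle {q : ℕ} {A B : Finset (Fin (2 * q + 1))} (hA : A.card = q + 1)
    (hB : B.card = q + 1) : A.image (shuffle hA hB) = B := by
  have h : (Finset.univ.image
      (finSumEquivOfFinset hA (card_compl_of_card_eq hA) ∘ Sum.inl)).image (shuffle hA hB) =
      Finset.univ.image (finSumEquivOfFinset hB (card_compl_of_card_eq hB) ∘ Sum.inl) := by
    rw [Finset.image_image]
    congr 1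
    ext i
    simp [shuffle, -finSumEquivOfFinset_inl]
  rwa [image_finSumEquivOfFinset_inl, image_finSumEquivOfFinset_inl] at h

theorem inl_succ_lt_inr_of_mem_positionSets {q : ℕ} {A : Finset (Fin (2 * q + 1))}
    (hA : A ∈ positionSets q) (hcard : A.card = q + 1) (t : Fin q) :
    finSumEquivOfFinset hcard (card_compl_of_card_eq hcard) (Sum.inl t.succ) <
      finSumEquivOfFinset hcard (card_compl_of_card_eq hcard) (Sum.inr t) := by
  rw [finSumEquivOfFinset_inl, finSumEquivOfFinset_inr]
  by_contra! hle
  have hmem : Aᶜ.orderEmbOfFin (card_compl_of_card_eq hcard) t ∉ A :=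
    Finset.mem_compl.mp (Finset.orderEmbOfFin_mem _ _ t)
  have h1 := (Finset.mem_filter.mp hA).2.2 _ hmem
  have h2 := Finset.card_filter_lt_le_of_le_orderEmbOfFin hcard hle
  rw [Finset.card_filter_orderEmbOfFin_lt] at h1
  rw [Fin.val_succ] at h2
  omega

theorem inr_lt_inl_castSucc_of_mem_valueSets {q : ℕ} {B : Finset (Fin (2 * q + 1))}
    (hB : B ∈ valueSets q) (hcard : B.card = q + 1) (t : Fin q) :
    finSumEquivOfFinset hcard (card_compl_of_card_eq hcard) (Sum.inr t) <
      finSumEquivOfFinset hcard (card_compl_of_card_eq hcard) (Sum.inl t.castSucc) := by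
  rw [finSumEquivOfFinset_inl, finSumEquivOfFinset_inr]
  have hmem : Bᶜ.orderEmbOfFin (card_compl_of_card_eq hcard) t ∉ B :=
    Finset.mem_compl.mp (Finset.orderEmbOfFin_mem _ _ t)
  by_contra! hle
  have hlt : B.orderEmbOfFin hcard t.castSucc <
      Bᶜ.orderEmbOfFin (card_compl_of_card_eq hcard) t :=
    lt_of_le_of_ne hle fun heq => hmem (heq ▸ Finset.orderEmbOfFin_mem _ _ _)
  have h1 := (Finset.mem_filter.mp hB).2.2 _ hmem
  have h2 := Finset.lt_card_filter_lt_of_orderEmbOfFin_lt hcard hlt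
  rw [Finset.card_filter_orderEmbOfFin_lt] at h1
  rw [Fin.val_castSucc] at h2
  omega

theorem card_positionSets_mul_card_valueSets_le (q : ℕ) :
    (positionSets q).card * (valueSets q).card ≤ uNum pattern321 (2 * q + 1) := by
  have hpos : ∀ A : positionSets q, A.1.card = q + 1 := fun A => (Finset.mem_filter.mp A.2).2.1
  have hval : ∀ B : valueSets q, B.1.card = q + 1 := fun B => (Finset.mem_filter.mp B.2).2.1
  have hprop : ∀ x : positionSets q × valueSets q,
      Avoids pattern321 (shuffle (hpos x.1) (hval x.2)) ∧
        HasULIS (shuffle (hpos x.1) (hval x.2)) := fun x =>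
    ⟨avoids_pattern321_of_strictMono (strictMono_finSumEquivOfFinset_inl _)
      (strictMono_finSumEquivOfFinset_inr _) (strictMono_finSumEquivOfFinset_inl _)
      (strictMono_finSumEquivOfFinset_inr _),
     hasULIS_of_ballot (strictMono_finSumEquivOfFinset_inl _)
      (strictMono_finSumEquivOfFinset_inl _)
      (inl_succ_lt_inr_of_mem_positionSets x.1.2 _)
      (inr_lt_inl_castSucc_of_mem_valueSets x.2.2 _)⟩
  have hcard : Nat.card (positionSets q × valueSets q) =
      (positionSets q).card * (valueSets q).card := by
    rw [Nat.card_prod, Nat.card_eq_fintype_card, Nat.card_eq_fintype_card, Fintype.card_coe,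
      Fintype.card_coe]
  rw [← hcard]
  refine Nat.card_le_card_of_injective (fun x => ⟨_, hprop x⟩) ?_
  rintro ⟨A, B⟩ ⟨A', B'⟩ h
  have hp : shuffle (hpos A) (hval B) = shuffle (hpos A') (hval B') := congrArg Subtype.val h
  have hinc : IsIncSubseq (shuffle (hpos A') (hval B')) A.1 := by
    rw [← hp]
    have := isIncSubseq_image_inl (strictMono_finSumEquivOfFinset_inl (hpos A))
      (strictMono_finSumEquivOfFinset_inl (hval B))
    rwa [image_finSumEquivOfFinset_inl] at this
  have hA : A = A' := by
    have := eq_image_inl_of_isIncSubseq (strictMono_finSumEquivOfFinset_inl (hpos A'))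
      (strictMono_finSumEquivOfFinset_inl (hval B'))
      (inl_succ_lt_inr_of_mem_positionSets A'.2 _)
      (inr_lt_inl_castSucc_of_mem_valueSets B'.2 _) hinc (hpos A)
    rw [image_finSumEquivOfFinset_inl] at this
    exact Subtype.ext this
  subst hA
  have hB : B = B' := by
    apply Subtype.ext
    rw [← image_shuffle (hpos A) (hval B), hp, image_shuffle]
  rw [hB]

/-- The set of positions `i < n` at which the list `l` has the entry `a`. -/
def positionsOf {α : Type*} [DecidableEq α] (n : ℕ) (l : List α) (a : α) : Finset (Fin n) :=
  Finset.univ.filter fun i => l[i.val]? = some a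

theorem card_filter_positionsOf {α : Type*} [DecidableEq α] {n : ℕ} (l : List α) (a : α) {m : ℕ}
    (hm : m ≤ n) :
    ((positionsOf n l a).filter fun i => i.val < m).card = (l.take m).count a := by
  induction m with
  | zero => simp
  | succ m ih =>
    have ih' := ih (by omega)
    rw [List.take_add_one, List.count_append, ← ih']
    by_cases h : l[m]? = some a
    · have hins : ((positionsOf n l a).filter fun i => i.val < m + 1) =
          insert ⟨m, hm⟩ ((positionsOf n l a).filter fun i => i.val < m) := by
        ext i
        simp only [positionsOf, Finset.mem_filter, Finset.mem_univ, true_and, Finset.mem_insert,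
          Fin.ext_iff]
        constructor
        · rintro ⟨h1, h2⟩
          by_cases him : i.val = m
          · exact Or.inl him
          · exact Or.inr ⟨h1, by omega⟩
        · rintro (h1 | ⟨h1, h2⟩)
          · exact ⟨by rw [h1]; exact h, by omega⟩
          · exact ⟨h1, by omega⟩
      rw [hins, Finset.card_insert_of_notMem (by simp), h]
      simp
    · have hsame : ((positionsOf n l a).filter fun i => i.val < m + 1) =
          (positionsOf n l a).filter fun i => i.val < m := by
        refine Finset.filter_congr fun i hi => ?_
        have him : i.val ≠ m := fun him => h (him ▸ (Finset.mem_filter.mp hi).2)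
        omega
      rw [hsame]
      have hz : (l[m]?.toList).count a = 0 := by
        rw [List.count_eq_zero]
        simpa using h
      omega

theorem card_positionsOf {α : Type*} [DecidableEq α] {n : ℕ} {l : List α} (hl : l.length = n)
    (a : α) : (positionsOf n l a).card = l.count a := by
  have h := card_filter_positionsOf (n := n) l a le_rfl
  rwa [Finset.filter_true_of_mem fun i _ => i.2, List.take_of_length_le hl.le] at h

theorem compl_positionsOf {n : ℕ} {l : List DyckStep} (hl : l.length = n) {a b : DyckStep}
    (hab : a ≠ b) : (positionsOf n l a)ᶜ = positionsOf n l b := by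
  ext i
  have hi : i.val < l.length := by omega
  simp only [positionsOf, Finset.mem_compl, Finset.mem_filter, Finset.mem_univ, true_and,
    List.getElem?_eq_getElem hi, Option.some_inj]
  generalize l[i.val] = s
  cases a <;> cases b <;> cases s <;> simp_all

theorem positionsOf_injective {n : ℕ} {l l' : List DyckStep} (hl : l.length = n)
    (hl' : l'.length = n) {a : DyckStep} (h : positionsOf n l a = positionsOf n l' a) :
    l = l' := by
  refine List.ext_getElem (hl.trans hl'.symm) fun i h1 h2 => ?_
  have hi := Finset.ext_iff.mp h ⟨i, by omega⟩
  simp only [positionsOf, Finset.mem_filter, Finset.mem_univ, true_and,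
    List.getElem?_eq_getElem h1, List.getElem?_eq_getElem h2, Option.some_inj] at hi
  generalize l[i] = s at hi ⊢
  generalize l'[i] = s' at hi ⊢
  cases a <;> cases s <;> cases s' <;> simp_all

theorem positionsOf_cons_mem_positionSets {q : ℕ} (w : DyckWord) (hw : w.semilength = q) :
    positionsOf (2 * q + 1) (DyckStep.U :: w.toList) DyckStep.U ∈ positionSets q := by
  have hlen : (DyckStep.U :: w.toList).length = 2 * q + 1 := by
    rw [List.length_cons, ← w.two_mul_semilength_eq_length, hw]
  refine Finset.mem_filter.mpr ⟨Finset.mem_univ _, ?_, fun x hx => ?_⟩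
  · rw [card_positionsOf hlen, List.count_cons_self]
    exact congrArg (· + 1) hw
  · have hx' : x ∈ positionsOf (2 * q + 1) (DyckStep.U :: w.toList) DyckStep.D := by
      rw [← compl_positionsOf hlen (a := DyckStep.U) (by decide)]
      exact Finset.mem_compl.mpr hx
    rw [compl_positionsOf hlen (b := DyckStep.D) (by decide)]
    have h1 := card_filter_positionsOf (DyckStep.U :: w.toList) DyckStep.D x.2.le
    have h2 := card_filter_positionsOf (DyckStep.U :: w.toList) DyckStep.U x.2.le
    simp only [Fin.lt_def]
    rw [h1, h2]
    have hget := (Finset.mem_filter.mp hx').2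
    obtain ⟨m, hm⟩ : ∃ m, x.val = m + 1 := by
      refine Nat.exists_eq_succ_of_ne_zero fun h0 => ?_
      rw [h0] at hget
      simp at hget
    rw [hm, List.getElem?_cons_succ] at hget
    rw [hm, List.take_succ_cons, List.count_cons_self, List.count_cons_of_ne (by decide)]
    have hdyck := w.count_D_le_count_U (m + 1)
    rw [List.take_add_one, hget] at hdyck
    simp only [Option.toList_some, List.count_append, List.count_singleton_self] at hdyck
    rw [List.count_singleton] at hdyck
    simp at hdyck
    omega

theorem positionsOf_append_mem_valueSets {q : ℕ} (w : DyckWord) (hw : w.semilength = q) :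
    positionsOf (2 * q + 1) (w.toList ++ [DyckStep.D]) DyckStep.D ∈ valueSets q := by
  have hlen' : w.toList.length = 2 * q := by rw [← w.two_mul_semilength_eq_length, hw]
  have hlen : (w.toList ++ [DyckStep.D]).length = 2 * q + 1 := by
    rw [List.length_append, hlen', List.length_singleton]
  refine Finset.mem_filter.mpr ⟨Finset.mem_univ _, ?_, fun y _ => ?_⟩
  · rw [card_positionsOf hlen, List.count_append, List.count_singleton_self,
      ← w.semilength_eq_count_D, hw]
  · rw [compl_positionsOf hlen (b := DyckStep.U) (by decide)]
    have h1 := card_filter_positionsOf (w.toList ++ [DyckStep.D]) DyckStep.D y.2.le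
    have h2 := card_filter_positionsOf (w.toList ++ [DyckStep.D]) DyckStep.U y.2.le
    simp only [Fin.lt_def]
    rw [h1, h2, List.take_append_of_le_length (by omega)]
    exact w.count_D_le_count_U y

theorem catalan_le_card_positionSets (q : ℕ) : catalan q ≤ (positionSets q).card := by
  rw [← DyckWord.card_dyckWord_semilength_eq_catalan, ← Fintype.card_coe]
  refine Fintype.card_le_of_injective
    (fun w => ⟨_, positionsOf_cons_mem_positionSets w.1 w.2⟩) fun w w' h => ?_
  have hlen : ∀ w : {w : DyckWord // w.semilength = q},
      (DyckStep.U :: w.1.toList).length = 2 * q + 1 := fun w => by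
    rw [List.length_cons, ← w.1.two_mul_semilength_eq_length, w.2]
  have := positionsOf_injective (hlen w) (hlen w') (congrArg Subtype.val h)
  exact Subtype.ext (DyckWord.ext (List.cons_inj_right _ |>.mp this))

theorem catalan_le_card_valueSets (q : ℕ) : catalan q ≤ (valueSets q).card := by
  rw [← DyckWord.card_dyckWord_semilength_eq_catalan, ← Fintype.card_coe]
  refine Fintype.card_le_of_injective
    (fun w => ⟨_, positionsOf_append_mem_valueSets w.1 w.2⟩) fun w w' h => ?_
  have hlen : ∀ w : {w : DyckWord // w.semilength = q},
      (w.1.toList ++ [DyckStep.D]).length = 2 * q + 1 := fun w => by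
    rw [List.length_append, ← w.1.two_mul_semilength_eq_length, w.2, List.length_singleton]
  have := positionsOf_injective (hlen w) (hlen w') (congrArg Subtype.val h)
  exact Subtype.ext (DyckWord.ext (List.append_left_inj _ |>.mp this))

theorem catalan_sq_le_uNum_pattern321 (q : ℕ) :
    catalan q ^ 2 ≤ uNum pattern321 (2 * q + 1) := by
  rw [sq]
  exact (Nat.mul_le_mul (catalan_le_card_positionSets q) (catalan_le_card_valueSets q)).trans
    (card_positionSets_mul_card_valueSets_le q)

theorem four_pow_le_mul_catalan (q : ℕ) : 4 ^ q ≤ 2 * (q + 1) ^ 2 * catalan q := by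
  rcases Nat.eq_zero_or_pos q with rfl | hq
  · simp
  · calc 4 ^ q ≤ 2 * q * q.centralBinom := Nat.four_pow_le_two_mul_self_mul_centralBinom q hq
      _ = 2 * q * ((q + 1) * catalan q) := by rw [succ_mul_catalan_eq_centralBinom]
      _ ≤ 2 * (q + 1) * ((q + 1) * catalan q) := by gcongr; omega
      _ = 2 * (q + 1) ^ 2 * catalan q := by ring

open Filter in
theorem not_geometric_bound_uNum_pattern321 {r C : ℝ} (hr : 0 < r) (hr4 : r < 4)
    (h : ∀ n, (uNum pattern321 n : ℝ) ≤ C * r ^ n) : False := by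
  set x := r ^ 2 / 16 with hx
  have hx0 : 0 < x := by positivity
  have hx1 : x < 1 := by
    rw [hx, div_lt_one (by norm_num)]
    nlinarith
  have hbound : ∀ q : ℕ, x ≤ 4 * C * r * (((q + 1 : ℕ) : ℝ) ^ 4 * x ^ (q + 1)) := by
    intro q
    have h1 : (4 : ℝ) ^ q ≤ 2 * (q + 1) ^ 2 * catalan q := by
      exact_mod_cast four_pow_le_mul_catalan q
    have h2 : (catalan q : ℝ) ^ 2 ≤ uNum pattern321 (2 * q + 1) := by
      exact_mod_cast catalan_sq_le_uNum_pattern321 q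
    have h3 : (16 : ℝ) ^ q ≤ 4 * (q + 1) ^ 4 * (C * r ^ (2 * q + 1)) := by
      calc (16 : ℝ) ^ q = (4 ^ q) ^ 2 := by rw [← pow_mul, mul_comm q, pow_mul]; norm_num
        _ ≤ (2 * (q + 1) ^ 2 * catalan q) ^ 2 := by gcongr
        _ = 4 * (q + 1) ^ 4 * (catalan q : ℝ) ^ 2 := by ring
        _ ≤ 4 * (q + 1) ^ 4 * (C * r ^ (2 * q + 1)) := by
            gcongr
            exact h2.trans (h _)
    have h4 : r ^ (2 * q + 1) = r * (16 ^ q * x ^ q) := by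
      rw [← mul_pow, hx, mul_div_cancel₀ _ (by norm_num), pow_succ, pow_mul, mul_comm]
    have h5 : 1 ≤ 4 * C * r * (((q : ℝ) + 1) ^ 4 * x ^ q) := by
      refine le_of_mul_le_mul_left ?_ (by positivity : (0 : ℝ) < 16 ^ q)
      calc (16 : ℝ) ^ q * 1 = 16 ^ q := mul_one _
        _ ≤ _ := h3
        _ = 16 ^ q * (4 * C * r * (((q : ℝ) + 1) ^ 4 * x ^ q)) := by rw [h4]; ring
    calc x = 1 * x := (one_mul x).symm
      _ ≤ 4 * C * r * (((q : ℝ) + 1) ^ 4 * x ^ q) * x := by gcongr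
      _ = _ := by push_cast; ring
  have hlim : Tendsto (fun q : ℕ => 4 * C * r * (((q + 1 : ℕ) : ℝ) ^ 4 * x ^ (q + 1))) atTop
      (nhds (4 * C * r * 0)) :=
    ((tendsto_add_atTop_iff_nat 1).mpr (tendsto_pow_const_mul_const_pow_of_abs_lt_one 4
      (by rwa [abs_of_pos hx0]))).const_mul _
  rw [mul_zero] at hlim
  exact absurd (ge_of_tendsto' hlim hbound) (not_le.mpr hx0)

/-- The generating function `U(z) = Σ_{n≥0} u_n(321) zⁿ` over `ℚ` is not rational:
there are no polynomials `P, Q` with `Q ≠ 0` and `Q·U = P` as formal power series. -/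
theorem u321_genfun_not_rational :
    ¬ ∃ (P Q : Polynomial ℚ), Q ≠ 0 ∧
      (Q : PowerSeries ℚ) * PowerSeries.mk (fun n => (uNum pattern321 n : ℚ))
        = (P : PowerSeries ℚ) := by
  rintro ⟨P, Q, hQ, h⟩
  have hmap : ((Q.map (algebraMap ℚ ℂ) : Polynomial ℂ) : PowerSeries ℂ) *
      PowerSeries.mk (fun n => (uNum pattern321 n : ℂ)) =
        ((P.map (algebraMap ℚ ℂ) : Polynomial ℂ) : PowerSeries ℂ) := by
    rw [Polynomial.polynomial_map_coe, Polynomial.polynomial_map_coe, ← h, map_mul]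
    congr 1
  obtain ⟨r, C, hr, hr4, -, hb⟩ := PowerSeries.exists_geometric_bound_of_isLittleO
    (by norm_num : (0 : ℝ) < 4) (by simpa using uNum_pattern321_isLittleO)
    ((Polynomial.map_ne_zero_iff (algebraMap ℚ ℂ).injective).mpr hQ) hmap
  exact not_geometric_bound_uNum_pattern321 hr hr4 fun n => by simpa using hb n
end

section
/- The limit as n → ∞ of u_n(132)/C_n equals 1/2, where u_n(132) is the number of 132-avoiding permutations of length n with a unique longest increasing subsequence and C_n = binomial(2n,n)/(n+1) is the n-th Catalan number (which counts all 132-avoiding permutations of length n). -/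
open BinaryTree

/-- The word on the letters `b, b + 1, …` attached to a binary tree: the root carries the largest
letter, and the letters of the left subtree exceed those of the right subtree. -/
def treeWord : BinaryTree Unit → ℕ → List ℕ
  | nil, _ => []
  | node _ l r, b =>
    treeWord l (b + r.numNodes) ++ (b + r.numNodes + l.numNodes) :: treeWord r b

/-- The word `w` has no subsequence `a c b` with `a < b < c`. -/
def WordAvoids132 (w : List ℕ) : Prop :=
  ∀ a b c : ℕ, List.Sublist [a, c, b] w → ¬ (a < b ∧ b < c)

theorem treeWord_perm (t : BinaryTree Unit) (b : ℕ) :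
    (treeWord t b).Perm (List.range' b t.numNodes) := by
  induction t generalizing b with
  | nil => simp [treeWord, numNodes]
  | node _ l r hl hr =>
    have e : (node () l r).numNodes = r.numNodes + (l.numNodes + 1) := by
      simp [numNodes]; omega
    simp only [treeWord]
    rw [e, ← List.range'_append_1, List.range'_1_concat]
    refine (List.perm_middle.trans ?_)
    refine List.Perm.trans ?_ List.perm_append_comm
    rw [List.append_assoc]
    refine List.Perm.trans ?_ List.perm_middle.symm
    exact (List.Perm.append (hl _) (hr _)).cons _

theorem length_treeWord (t : BinaryTree Unit) (b : ℕ) : (treeWord t b).length = t.numNodes := by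
  simpa using (treeWord_perm t b).length_eq

theorem mem_treeWord {t : BinaryTree Unit} {b x : ℕ} :
    x ∈ treeWord t b ↔ b ≤ x ∧ x < b + t.numNodes := by
  rw [(treeWord_perm t b).mem_iff, List.mem_range'_1]

theorem treeWord_avoids (t : BinaryTree Unit) (b : ℕ) : WordAvoids132 (treeWord t b) := by
  induction t generalizing b with
  | nil => intro x y z h; simp [treeWord] at h
  | node _ l r hl hr =>
    rintro x y z h ⟨h1, h2⟩
    simp only [treeWord] at h
    obtain ⟨s₁, s₂, hs, hs₁, hs₂⟩ := List.sublist_append_iff.mp h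
    have m₁ : ∀ v ∈ s₁, b + r.numNodes ≤ v ∧ v < b + r.numNodes + l.numNodes :=
      fun v hv => mem_treeWord.mp (hs₁.subset hv)
    have m₂ : ∀ v ∈ s₂, v = b + r.numNodes + l.numNodes ∨ (b ≤ v ∧ v < b + r.numNodes) := by
      intro v hv
      have := hs₂.subset hv
      simpa [mem_treeWord] using this
    rcases s₁ with _ | ⟨a₁, _ | ⟨a₂, _ | ⟨a₃, _ | ⟨a₄, s₁⟩⟩⟩⟩
    · simp only [List.nil_append] at hs
      subst hs
      rcases List.sublist_cons_iff.mp hs₂ with h3 | ⟨r', h3, h4⟩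
      · exact hr _ _ _ _ h3 ⟨h1, h2⟩
      · have hx := m₂ x (by simp)
        have hy := m₂ y (by simp)
        have hz := m₂ z (by simp)
        simp at h3
        omega
    · simp at hs
      obtain ⟨rfl, rfl⟩ := hs
      have hx := m₁ x (by simp)
      have hy := m₂ y (by simp)
      have hz := m₂ z (by simp)
      omega
    · simp at hs
      obtain ⟨rfl, rfl, rfl⟩ := hs
      have hx := m₁ x (by simp)
      have hy := m₂ y (by simp)
      have hz := m₁ z (by simp)
      omega
    · simp at hs
      obtain ⟨rfl, rfl, rfl, rfl⟩ := hs
      exact hl _ _ _ _ hs₁ ⟨h1, h2⟩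
    · simp at hs

theorem treeWord_injective (b : ℕ) : Function.Injective fun t => treeWord t b := by
  intro t
  induction t generalizing b with
  | nil =>
    intro t' h
    have := congrArg List.length h
    simp only [length_treeWord] at this
    cases t' with
    | nil => rfl
    | node _ _ _ => simp [numNodes] at this
  | node _ l r hl hr =>
    intro t' h
    have hlen := congrArg List.length h
    simp only [length_treeWord] at hlen
    cases t' with
    | nil => simp [numNodes] at hlen
    | node _ l' r' =>
      simp only [treeWord] at h
      have e : b + r.numNodes + l.numNodes = b + r'.numNodes + l'.numNodes := by
        simp [numNodes] at hlen; omega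
      rw [← e] at h
      have h1 : b + r.numNodes + l.numNodes ∉ treeWord l (b + r.numNodes) := by
        rw [mem_treeWord]; omega
      have h2 : b + r.numNodes + l.numNodes ∉ treeWord r b := by
        rw [mem_treeWord]; omega
      obtain ⟨h3, -, h4⟩ := (List.append_cons_inj_of_notMem h1 h2).mp h
      have h5 : r = r' := hr _ h4
      subst h5
      have h6 : l = l' := hl _ h3
      subst h6
      rfl

theorem perm_range'_of_append {L R : List ℕ} {b n : ℕ}
    (h : (L ++ R).Perm (List.range' b n)) (hlt : ∀ x ∈ L, ∀ y ∈ R, y < x) :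
    R.Perm (List.range' b R.length) ∧ L.Perm (List.range' (b + R.length) L.length) := by
  have hn : n = R.length + L.length := by
    have := h.length_eq
    simp at this; omega
  have pR := List.mergeSort_perm R (· ≤ ·)
  have pL := List.mergeSort_perm L (· ≤ ·)
  have sR : (R.mergeSort (· ≤ ·)).Pairwise (· ≤ ·) := by
    simpa using List.pairwise_mergeSort (le := fun a b : ℕ => decide (a ≤ b))
      (by simp; intros; omega) (by simp; intros; omega) R
  have sL : (L.mergeSort (· ≤ ·)).Pairwise (· ≤ ·) := by
    simpa using List.pairwise_mergeSort (le := fun a b : ℕ => decide (a ≤ b))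
      (by simp; intros; omega) (by simp; intros; omega) L
  have key : R.mergeSort (· ≤ ·) ++ L.mergeSort (· ≤ ·) = List.range' b n := by
    refine List.Perm.eq_of_pairwise (le := (· ≤ ·)) (fun a b _ _ h h' => le_antisymm h h') ?_
      (List.pairwise_le_range') ?_
    · rw [List.pairwise_append]
      refine ⟨sR, sL, fun y hy x hx => (hlt x ?_ y ?_).le⟩
      · simpa using hx
      · simpa using hy
    · exact ((pR.append pL).trans List.perm_append_comm).trans h
  rw [hn, ← List.range'_append_1] at key
  obtain ⟨h1, h2⟩ := List.append_inj key (by simp)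
  exact ⟨h1 ▸ pR.symm, h2 ▸ pL.symm⟩

theorem WordAvoids132.sublist {w w' : List ℕ} (h : WordAvoids132 w) (hw : w'.Sublist w) :
    WordAvoids132 w' := fun a b c h' => h a b c (h'.trans hw)

theorem exists_treeWord_eq {w : List ℕ} {b n : ℕ} (hw : w.Perm (List.range' b n))
    (ha : WordAvoids132 w) : ∃ t : BinaryTree Unit, t.numNodes = n ∧ treeWord t b = w := by
  induction n using Nat.strong_induction_on generalizing b w with
  | _ n ih =>
  rcases n with _ | n
  · exact ⟨nil, rfl, by simpa [treeWord] using hw.eq_nil.symm⟩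
  have hm : b + n ∈ w := by
    rw [hw.mem_iff, List.mem_range'_1]; omega
  obtain ⟨L, R, rfl⟩ := List.append_of_mem hm
  have hLR : (L ++ R).Perm (List.range' b n) := by
    have h1 := List.perm_middle.symm.trans hw
    rw [List.range'_1_concat] at h1
    exact (h1.trans List.perm_append_comm).cons_inv
  have hnd : (L ++ R).Nodup := hLR.nodup_iff.mpr (List.nodup_range' )
  have hlt : ∀ x ∈ L, ∀ y ∈ R, y < x := by
    intro x hx y hy
    by_contra hxy
    have hne : x ≠ y := by
      rintro rfl
      exact (List.disjoint_of_nodup_append hnd) hx hy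
    have hy' : y < b + n := by
      have := hLR.mem_iff.mp (List.mem_append_right L hy)
      rw [List.mem_range'_1] at this; omega
    refine ha x y (b + n) ?_ ⟨by omega, hy'⟩
    exact List.Sublist.append (List.singleton_sublist.mpr hx)
      ((List.singleton_sublist.mpr hy).cons_cons _)
  have hlen : L.length + R.length = n := by simpa using hLR.length_eq
  obtain ⟨pR, pL⟩ := perm_range'_of_append hLR hlt
  obtain ⟨r, hr, hr'⟩ := ih R.length (by omega) pR
    (ha.sublist ((List.sublist_cons_self _ _).trans (List.sublist_append_right _ _)))
  obtain ⟨l, hl, hl'⟩ := ih L.length (by omega) pL (ha.sublist (List.sublist_append_left _ _))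
  refine ⟨node () l r, by simp [numNodes]; omega, ?_⟩
  simp only [treeWord, hr, hl, hr', hl']
  congr 2; omega

/-- `h` is the largest length of an increasing subsequence of `w`, and `U` says that this length
is attained once. -/
def LongestIncSpec (w : List ℕ) (h : ℕ) (U : Prop) : Prop :=
  (∀ s : List ℕ, s.Sublist w → s.Pairwise (· < ·) → s.length ≤ h) ∧
  (∃ s : List ℕ, s.Sublist w ∧ s.Pairwise (· < ·) ∧ s.length = h) ∧
  (U ↔ ∃! s : List ℕ, s.Sublist w ∧ s.Pairwise (· < ·) ∧ s.length = h)

theorem LongestIncSpec.append_singleton {w : List ℕ} {h : ℕ} {U : Prop} {m : ℕ}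
    (hw : LongestIncSpec w h U) (hm : ∀ x ∈ w, x < m) :
    LongestIncSpec (w ++ [m]) (h + 1) U := by
  obtain ⟨h1, ⟨s₀, hs₀, hi₀, hl₀⟩, h3⟩ := hw
  have split : ∀ s : List ℕ, s.Sublist (w ++ [m]) → s.Pairwise (· < ·) →
      s.length ≤ h ∨ ∃ s', s = s' ++ [m] ∧ s'.Sublist w ∧ s'.Pairwise (· < ·) := by
    intro s hs hi
    obtain ⟨s₁, s₂, rfl, hs₁, hs₂⟩ := List.sublist_append_iff.mp hs
    rcases List.sublist_singleton.mp hs₂ with rfl | rfl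
    · left; simp only [List.append_nil] at hi ⊢; exact h1 _ hs₁ hi
    · right; exact ⟨s₁, rfl, hs₁, (List.pairwise_append.mp hi).1⟩
  have ext : ∀ s : List ℕ, s.Sublist w → s.Pairwise (· < ·) →
      (s ++ [m]).Sublist (w ++ [m]) ∧ (s ++ [m]).Pairwise (· < ·) := by
    intro s hs hi
    refine ⟨hs.append (List.Sublist.refl _), ?_⟩
    rw [List.pairwise_append]
    refine ⟨hi, by simp, fun x hx y hy => ?_⟩
    rw [List.mem_singleton] at hy
    exact hy ▸ hm x (hs.subset hx)
  refine ⟨?_, ?_, ?_⟩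
  · intro s hs hi
    rcases split s hs hi with h | ⟨s', rfl, hs', hi'⟩
    · omega
    · simpa using h1 s' hs' hi'
  · exact ⟨s₀ ++ [m], (ext s₀ hs₀ hi₀).1, (ext s₀ hs₀ hi₀).2, by simp [hl₀]⟩
  · rw [h3]
    constructor
    · rintro ⟨s, ⟨hs, hi, hl⟩, hu⟩
      refine ⟨s ++ [m], ⟨(ext s hs hi).1, (ext s hs hi).2, by simp [hl]⟩, ?_⟩
      rintro s' ⟨hs', hi', hl'⟩
      rcases split s' hs' hi' with h | ⟨s'', rfl, hs'', hi''⟩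
      · omega
      · rw [hu s'' ⟨hs'', hi'', by simpa using hl'⟩]
    · rintro ⟨s, -, hu⟩
      refine ⟨s₀, ⟨hs₀, hi₀, hl₀⟩, ?_⟩
      rintro s' ⟨hs', hi', hl'⟩
      have e1 := hu (s₀ ++ [m]) ⟨(ext s₀ hs₀ hi₀).1, (ext s₀ hs₀ hi₀).2, by simp [hl₀]⟩
      have e2 := hu (s' ++ [m]) ⟨(ext s' hs' hi').1, (ext s' hs' hi').2, by simp [hl']⟩
      exact List.append_cancel_right (e2.trans e1.symm)

theorem LongestIncSpec.append {w w' : List ℕ} {h k : ℕ} {U V : Prop}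
    (hw : LongestIncSpec w h U) (hw' : LongestIncSpec w' k V) (hh : 0 < h)
    (hlt : ∀ x ∈ w, ∀ y ∈ w', y < x) :
    LongestIncSpec (w ++ w') (max h k) ((k < h ∧ U) ∨ (h < k ∧ V)) := by
  obtain ⟨h1, ⟨s₀, hs₀, hi₀, hl₀⟩, h3⟩ := hw
  obtain ⟨k1, ⟨r₀, hr₀, ri₀, rl₀⟩, k3⟩ := hw'
  have split : ∀ s : List ℕ, s.Sublist (w ++ w') → s.Pairwise (· < ·) →
      (s.Sublist w ∨ s.Sublist w') := by
    intro s hs hi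
    obtain ⟨s₁, s₂, rfl, hs₁, hs₂⟩ := List.sublist_append_iff.mp hs
    rcases s₁ with _ | ⟨x, s₁⟩
    · right; simpa using hs₂
    rcases s₂ with _ | ⟨y, s₂⟩
    · left; simpa using hs₁
    have a := (List.pairwise_append.mp hi).2.2 x (by simp) y (by simp)
    have b := hlt x (hs₁.subset (by simp)) y (hs₂.subset (by simp))
    omega
  have left : ∀ s : List ℕ, s.Sublist w → s.Sublist (w ++ w') :=
    fun s hs => hs.trans (List.sublist_append_left _ _)
  have right : ∀ s : List ℕ, s.Sublist w' → s.Sublist (w ++ w') :=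
    fun s hs => hs.trans (List.sublist_append_right _ _)
  refine ⟨?_, ?_, ?_⟩
  · intro s hs hi
    rcases split s hs hi with h | h
    · exact (h1 s h hi).trans (le_max_left _ _)
    · exact (k1 s h hi).trans (le_max_right _ _)
  · rcases le_total k h with hk | hk
    · exact ⟨s₀, left _ hs₀, hi₀, by rw [max_eq_left hk, hl₀]⟩
    · exact ⟨r₀, right _ hr₀, ri₀, by rw [max_eq_right hk, rl₀]⟩
  · rcases lt_trichotomy h k with hk | hk | hk
    · simp only [hk, not_lt.mpr hk.le, max_eq_right hk.le, k3, false_and, true_and, false_or]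
      refine existsUnique_congr fun s => ⟨fun h' => ⟨right _ h'.1, h'.2⟩, fun h' => ⟨?_, h'.2⟩⟩
      rcases split s h'.1 h'.2.1 with h'' | h''
      · have := h1 s h'' h'.2.1; omega
      · exact h''
    · subst hk
      simp only [lt_irrefl, false_and, false_or, max_self, false_iff]
      rintro ⟨s, -, hu⟩
      have e := (hu s₀ ⟨left _ hs₀, hi₀, hl₀⟩).trans (hu r₀ ⟨right _ hr₀, ri₀, rl₀⟩).symm
      obtain ⟨x, hx⟩ := List.exists_mem_of_length_pos (hl₀.symm ▸ hh)
      exact lt_irrefl x (hlt x (hs₀.subset hx) x (hr₀.subset (e ▸ hx)))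
    · simp only [hk, not_lt.mpr hk.le, max_eq_left hk.le, h3, false_and, true_and, or_false]
      refine existsUnique_congr fun s => ⟨fun h' => ⟨left _ h'.1, h'.2⟩, fun h' => ⟨?_, h'.2⟩⟩
      rcases split s h'.1 h'.2.1 with h'' | h''
      · exact h''
      · have := k1 s h'' h'.2.1; omega

/-- The height of the Dyck path attached to a binary tree; it is the length of a longest
increasing subsequence of the word of the tree. -/
def peakHeight : BinaryTree Unit → ℕ
  | nil => 0
  | node _ l r => max (peakHeight l + 1) (peakHeight r)

/-- The Dyck path attached to a binary tree reaches its height only once. -/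
def UniquePeak : BinaryTree Unit → Prop
  | nil => True
  | node _ l r => (peakHeight r < peakHeight l + 1 ∧ UniquePeak l) ∨
      (peakHeight l + 1 < peakHeight r ∧ UniquePeak r)

theorem longestIncSpec_treeWord (t : BinaryTree Unit) (b : ℕ) :
    LongestIncSpec (treeWord t b) (peakHeight t) (UniquePeak t) := by
  induction t generalizing b with
  | nil =>
    refine ⟨by simp [treeWord, peakHeight], ⟨[], by simp [treeWord, peakHeight]⟩, ?_⟩
    simp only [UniquePeak, treeWord, peakHeight, true_iff]
    exact ⟨[], by simp, by simp⟩
  | node _ l r hl hr =>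
    simp only [treeWord, peakHeight, UniquePeak]
    rw [List.append_cons]
    refine ((hl _).append_singleton ?_).append (hr b) (by omega) ?_
    · intro x hx
      rw [mem_treeWord] at hx; omega
    · intro x hx y hy
      rw [List.mem_append, List.mem_singleton, mem_treeWord] at hx
      rw [mem_treeWord] at hy; omega

/-- The word `p(1) p(2) ⋯ p(n)` of a permutation, with letters counted from `0`. -/
def permWord {n : ℕ} (p : Equiv.Perm (Fin n)) : List ℕ :=
  (List.finRange n).map fun i => (p i : ℕ)

theorem permWord_perm {n : ℕ} (p : Equiv.Perm (Fin n)) :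
    (permWord p).Perm (List.range' 0 n) := by
  have h : Function.Injective fun i => (p i : ℕ) := Fin.val_injective.comp p.injective
  refine (List.perm_ext_iff_of_nodup ((List.nodup_finRange n).map h) List.nodup_range').mpr ?_
  intro a
  simp only [List.mem_map, List.mem_finRange, true_and, List.mem_range'_1]
  constructor
  · rintro ⟨i, rfl⟩; omega
  · rintro ⟨-, ha⟩
    exact ⟨p.symm ⟨a, by omega⟩, by simp⟩

theorem permWord_injective {n : ℕ} : Function.Injective (permWord (n := n)) := by
  intro p q h
  ext i
  exact List.map_inj_left.mp h i (List.mem_finRange i)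

theorem exists_permWord_eq {n : ℕ} {w : List ℕ} (hw : w.Perm (List.range' 0 n)) :
    ∃ p : Equiv.Perm (Fin n), permWord p = w := by
  have hl : w.length = n := by simpa using hw.length_eq
  have hnd : w.Nodup := hw.nodup_iff.mpr List.nodup_range'
  have hlt : ∀ i : Fin n, w[(i : ℕ)]'(by omega) < n := by
    intro i
    have := hw.mem_iff.mp (List.getElem_mem (l := w) (n := i) (by omega))
    rw [List.mem_range'_1] at this; omega
  let f : Fin n → Fin n := fun i => ⟨w[(i : ℕ)]'(by omega), hlt i⟩
  have hf : Function.Injective f := by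
    intro i j hij
    have := congrArg Fin.val hij
    exact Fin.ext ((List.Nodup.getElem_inj_iff hnd).mp this)
  refine ⟨Equiv.ofBijective f (Finite.injective_iff_bijective.mp hf), ?_⟩
  refine List.ext_getElem (by simp [permWord, hl]) fun i h1 h2 => ?_
  simp [permWord, f]

theorem pairwise_sort_iff {n : ℕ} (s : Finset (Fin n)) (R : Fin n → Fin n → Prop) :
    (s.sort (· ≤ ·)).Pairwise R ↔ ∀ i ∈ s, ∀ j ∈ s, i < j → R i j := by
  have hs : (s.sort (· ≤ ·)).Pairwise (· < ·) := (s.sortedLT_sort).pairwise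
  constructor
  · intro h i hi j hj hij
    rw [← Finset.mem_sort (· ≤ ·)] at hi hj
    obtain ⟨a, ha, rfl⟩ := List.getElem_of_mem hi
    obtain ⟨b, hb, rfl⟩ := List.getElem_of_mem hj
    rw [List.pairwise_iff_getElem] at h hs
    rcases lt_trichotomy a b with hab | hab | hab
    · exact h a b ha hb hab
    · subst hab; exact absurd hij (lt_irrefl _)
    · exact absurd hij (hs b a hb ha hab).not_gt
  · intro h
    exact List.Pairwise.imp_of_mem (fun {a b} ha hb hab =>
      h a ((Finset.mem_sort _).mp ha) b ((Finset.mem_sort _).mp hb) hab) hs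

theorem sublist_permWord_iff {n : ℕ} {p : Equiv.Perm (Fin n)} {w : List ℕ} :
    w.Sublist (permWord p) ↔
      ∃ s : Finset (Fin n), w = (s.sort (· ≤ ·)).map fun i => (p i : ℕ) := by
  rw [permWord, List.sublist_map_iff]
  constructor
  · rintro ⟨l, hl, rfl⟩
    have h1 : l.Pairwise (· < ·) := (List.pairwise_lt_finRange n).sublist hl
    refine ⟨l.toFinset, ?_⟩
    congr 1
    exact ((List.toFinset_sort (· ≤ ·) (h1.imp (fun h => h.ne))).mpr (h1.imp fun h => h.le)).symm
  · rintro ⟨s, rfl⟩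
    refine ⟨_, ?_, rfl⟩
    refine List.sublist_of_subperm_of_pairwise (r := (· < ·)) ?_ (s.sortedLT_sort).pairwise
      (List.pairwise_lt_finRange n)
    exact (List.subperm_of_subset (s.sort_nodup _) fun i _ => List.mem_finRange i)

theorem hasULIS_iff {n : ℕ} {p : Equiv.Perm (Fin n)} {h : ℕ} {U : Prop}
    (hp : LongestIncSpec (permWord p) h U) : HasULIS ⇑p ↔ U := by
  obtain ⟨h1, ⟨s₀, hs₀, hi₀, hl₀⟩, h3⟩ := hp
  let φ : Finset (Fin n) → List ℕ := fun s => (s.sort (· ≤ ·)).map fun i => (p i : ℕ)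
  have φ_sub : ∀ s, (φ s).Sublist (permWord p) := fun s => sublist_permWord_iff.mpr ⟨s, rfl⟩
  have φ_inc : ∀ s, (φ s).Pairwise (· < ·) ↔ IsIncSubseq (⇑p) s := by
    intro s
    simp only [φ, List.pairwise_map, pairwise_sort_iff, IsIncSubseq, Fin.lt_def]
  have φ_len : ∀ s, (φ s).length = s.card := by intro s; simp [φ]
  have φ_inj : Function.Injective φ := by
    intro s t hst
    have := List.map_injective_iff.mpr
      (Fin.val_injective.comp p.injective : Function.Injective fun i => (p i : ℕ)) hst
    rw [← Finset.sort_toFinset s (· ≤ ·), this, Finset.sort_toFinset]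
  have hmax : ∀ s : Finset (Fin n), (IsIncSubseq (⇑p) s ∧
      ∀ t : Finset (Fin n), IsIncSubseq (⇑p) t → t.card ≤ s.card) ↔
      ((φ s).Sublist (permWord p) ∧ (φ s).Pairwise (· < ·) ∧ (φ s).length = h) := by
    intro s
    constructor
    · rintro ⟨hs, ht⟩
      refine ⟨φ_sub s, (φ_inc s).mpr hs, le_antisymm (h1 _ (φ_sub s) ((φ_inc s).mpr hs)) ?_⟩
      obtain ⟨t, rfl⟩ := sublist_permWord_iff.mp hs₀
      have := ht t ((φ_inc t).mp hi₀)
      rw [← hl₀]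
      exact (φ_len t).le.trans (this.trans (φ_len s).ge)
    · rintro ⟨-, hs, hl⟩
      refine ⟨(φ_inc s).mp hs, fun t ht => ?_⟩
      rw [← φ_len s, hl, ← φ_len t]
      exact h1 _ (φ_sub t) ((φ_inc t).mpr ht)
  rw [h3, HasULIS, existsUnique_congr hmax]
  constructor
  · rintro ⟨s, hs, hu⟩
    refine ⟨φ s, hs, fun w hw => ?_⟩
    obtain ⟨t, rfl⟩ := sublist_permWord_iff.mp hw.1
    exact congrArg φ (hu t hw)
  · rintro ⟨w, hw, hu⟩
    obtain ⟨t, rfl⟩ := sublist_permWord_iff.mp hw.1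
    exact ⟨t, hw, fun s hs => φ_inj (hu _ hs)⟩

theorem avoids_pattern132_iff {n : ℕ} (p : Equiv.Perm (Fin n)) :
    Avoids pattern132 p ↔ WordAvoids132 (permWord p) := by
  rw [Avoids, WordAvoids132]
  constructor
  · rintro h a b c hs ⟨hab, hbc⟩
    refine h ?_
    rw [permWord, List.sublist_map_iff] at hs
    obtain ⟨l, hl, hw⟩ := hs
    have h1 : l.Pairwise (· < ·) := (List.pairwise_lt_finRange n).sublist hl
    rcases l with _ | ⟨i, _ | ⟨j, _ | ⟨k, _ | ⟨_, _⟩⟩⟩⟩ <;> simp at hw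
    obtain ⟨rfl, rfl, rfl⟩ := hw
    simp at h1
    refine ⟨![i, j, k], ?_, ?_⟩
    · rw [Fin.strictMono_iff_lt_succ]
      intro x
      fin_cases x
      · exact h1.1.1
      · exact h1.2
    · intro x y
      fin_cases x <;> fin_cases y <;> simp [pattern132] <;> omega
  · rintro h ⟨f, hf, hp⟩
    refine h (p (f 0)) (p (f 2)) (p (f 1)) ?_ ⟨?_, ?_⟩
    · refine sublist_permWord_iff.mpr ⟨{f 0, f 1, f 2}, ?_⟩
      have h01 : f 0 < f 1 := hf (by decide)
      have h12 : f 1 < f 2 := hf (by decide)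
      have e : ({f 0, f 1, f 2} : Finset (Fin n)) = [f 0, f 1, f 2].toFinset := by simp
      rw [e, (List.toFinset_sort (· ≤ ·) (by simp; omega)).mpr (by simp; omega)]
      rfl
    · exact (hp 0 2).mpr (by decide)
    · exact (hp 2 1).mpr (by decide)

open Classical in
theorem uNum_pattern132_eq_card (n : ℕ) :
    uNum pattern132 n = ((treesOfNumNodesEq n).filter UniquePeak).card := by
  have exists_perm : ∀ t : BinaryTree Unit, t.numNodes = n →
      ∃ p : Equiv.Perm (Fin n), permWord p = treeWord t 0 :=
    fun t ht => exists_permWord_eq (ht ▸ treeWord_perm t 0)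
  choose! P hP using exists_perm
  have spec : ∀ t : BinaryTree Unit, t.numNodes = n →
      LongestIncSpec (permWord (P t)) (peakHeight t) (UniquePeak t) := by
    intro t ht
    rw [hP t ht]
    exact longestIncSpec_treeWord t 0
  rw [uNum, Nat.subtype_card (Finset.univ.filter fun p => Avoids pattern132 p ∧ HasULIS ⇑p)
    (by simp)]
  symm
  refine Finset.card_bij (fun t _ => P t) ?_ ?_ ?_
  · intro t ht
    rw [Finset.mem_filter, mem_treesOfNumNodesEq] at ht
    simp only [Finset.mem_filter, Finset.mem_univ, true_and]
    refine ⟨?_, (hasULIS_iff (spec t ht.1)).mpr ht.2⟩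
    rw [avoids_pattern132_iff, hP t ht.1]
    exact treeWord_avoids t 0
  · intro t ht t' ht' h
    rw [Finset.mem_filter, mem_treesOfNumNodesEq] at ht ht'
    apply treeWord_injective 0
    simp only [← hP t ht.1, ← hP t' ht'.1, h]
  · intro p hp
    simp only [Finset.mem_filter, Finset.mem_univ, true_and] at hp
    obtain ⟨t, ht, hw⟩ := exists_treeWord_eq (permWord_perm p)
      ((avoids_pattern132_iff p).mp hp.1)
    have e : P t = p := permWord_injective ((hP t ht).trans hw)
    refine ⟨t, ?_, e⟩
    rw [Finset.mem_filter, mem_treesOfNumNodesEq]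
    exact ⟨ht, (hasULIS_iff (spec t ht)).mp (e ▸ hp.2)⟩

open PowerSeries in
/-- The generating function of binary trees by number of nodes, weighted by `φ`. -/
noncomputable def treeSeries (φ : BinaryTree Unit → ℝ) : ℝ⟦X⟧ :=
  PowerSeries.mk fun n => ∑ t ∈ treesOfNumNodesEq n, φ t

theorem coeff_treeSeries (φ : BinaryTree Unit → ℝ) (n : ℕ) :
    (treeSeries φ).coeff n = ∑ t ∈ treesOfNumNodesEq n, φ t := PowerSeries.coeff_mk _ _

theorem treeSeries_add (φ ψ : BinaryTree Unit → ℝ) :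
    treeSeries (fun t => φ t + ψ t) = treeSeries φ + treeSeries ψ := by
  ext n
  simp [coeff_treeSeries, Finset.sum_add_distrib]

theorem treeSeries_eq_of_node {φ α β : BinaryTree Unit → ℝ}
    (h : ∀ l r, φ (node () l r) = α l * β r) :
    treeSeries φ = PowerSeries.C (φ nil) + PowerSeries.X * (treeSeries α * treeSeries β) := by
  ext n
  rcases n with _ | n
  · simp [coeff_treeSeries]
  · rw [map_add, PowerSeries.coeff_succ_X_mul, PowerSeries.coeff_mul, coeff_treeSeries,
      treesOfNumNodesEq_succ, Finset.sum_biUnion]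
    · simp only [PowerSeries.coeff_C, Nat.succ_ne_zero, if_false, zero_add]
      refine Finset.sum_congr rfl fun ij _ => ?_
      rw [coeff_treeSeries, coeff_treeSeries, Finset.sum_mul_sum, ← Finset.sum_product']
      rw [pairwiseNode, Finset.sum_map]
      refine Finset.sum_congr rfl fun x _ => ?_
      exact h _ _
    · simp_rw [Set.PairwiseDisjoint, Set.Pairwise, Function.onFun, Finset.disjoint_left]
      rintro ⟨i, j⟩ _ ⟨i', j'⟩ _ hne
      intro t ht ht'
      simp only [pairwiseNode, Finset.mem_map, Finset.mem_product, mem_treesOfNumNodesEq,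
        Prod.exists] at ht ht'
      obtain ⟨l, r, ⟨rfl, rfl⟩, rfl⟩ := ht
      obtain ⟨l', r', ⟨rfl, rfl⟩, h'⟩ := ht'
      simp at h'
      obtain ⟨rfl, rfl⟩ := h'
      exact hne rfl

theorem treeSeries_congr {φ ψ : BinaryTree Unit → ℝ} (h : ∀ t, φ t = ψ t) :
    treeSeries φ = treeSeries ψ := congrArg treeSeries (funext h)

open Classical PowerSeries in
/-- The generating function of binary trees of peak height less than `k`. -/
noncomputable def lowSeries (k : ℕ) : ℝ⟦X⟧ :=
  treeSeries fun t => if peakHeight t < k then 1 else 0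

open Classical PowerSeries in
/-- The generating function of binary trees of peak height `k` with a unique highest peak. -/
noncomputable def uniqueSeries (k : ℕ) : ℝ⟦X⟧ :=
  treeSeries fun t => if peakHeight t = k ∧ UniquePeak t then 1 else 0

theorem lowSeries_zero : lowSeries 0 = 0 := by
  ext n; simp [lowSeries, coeff_treeSeries]

theorem lowSeries_succ (k : ℕ) :
    lowSeries (k + 1) = 1 + PowerSeries.X * (lowSeries k * lowSeries (k + 1)) := by
  classical
  have h := treeSeries_eq_of_node (φ := fun t => if peakHeight t < k + 1 then 1 else 0)
    (α := fun t => if peakHeight t < k then 1 else 0)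
    (β := fun t => if peakHeight t < k + 1 then 1 else 0) (by
      intro l r
      simp only [peakHeight, max_lt_iff, add_lt_add_iff_right]
      split_ifs <;> simp_all)
  simpa [peakHeight, lowSeries] using h

theorem uniqueSeries_zero : uniqueSeries 0 = 1 := by
  classical
  have h := treeSeries_eq_of_node (φ := fun t => if peakHeight t = 0 ∧ UniquePeak t then 1 else 0)
    (α := fun _ => 0) (β := fun _ => 0) (by
      intro l r
      have : peakHeight (node () l r) ≠ 0 := by simp [peakHeight]
      simp [this])
  have h0 : treeSeries (fun _ => 0) = 0 := by ext n; simp [coeff_treeSeries]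
  rw [h0] at h
  simpa [peakHeight, UniquePeak, uniqueSeries] using h

theorem uniqueSeries_succ (k : ℕ) :
    uniqueSeries (k + 1) = PowerSeries.X * (uniqueSeries k * lowSeries (k + 1)) +
      PowerSeries.X * (lowSeries k * uniqueSeries (k + 1)) := by
  classical
  let φ₁ : BinaryTree Unit → ℝ
    | nil => 0
    | node _ l r => (if peakHeight l = k ∧ UniquePeak l then 1 else 0) *
        (if peakHeight r < k + 1 then 1 else 0)
  let φ₂ : BinaryTree Unit → ℝ
    | nil => 0
    | node _ l r => (if peakHeight l < k then 1 else 0) *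
        (if peakHeight r = k + 1 ∧ UniquePeak r then 1 else 0)
  have h₁ := treeSeries_eq_of_node (φ := φ₁) (fun l r => rfl)
  have h₂ := treeSeries_eq_of_node (φ := φ₂) (fun l r => rfl)
  have h : uniqueSeries (k + 1) = treeSeries φ₁ + treeSeries φ₂ := by
    rw [← treeSeries_add]
    refine treeSeries_congr fun t => ?_
    cases t with
    | nil => simp [φ₁, φ₂, peakHeight]
    | node _ l r =>
      simp only [φ₁, φ₂, peakHeight, UniquePeak, ite_zero_mul_ite_zero, mul_one]
      rcases lt_trichotomy (peakHeight r) (peakHeight l + 1) with hlt | hlt | hlt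
      · have e : max (peakHeight l + 1) (peakHeight r) = peakHeight l + 1 := by omega
        have n1 : ¬ (peakHeight l + 1 < peakHeight r) := by omega
        have n2 : ¬ ((peakHeight l < k) ∧ (peakHeight r = k + 1 ∧ UniquePeak r)) := by
          rintro ⟨h1, h2, -⟩; omega
        simp only [e, n1, n2, hlt, true_and, false_and, or_false, if_false, add_zero,
          add_left_inj]
        refine if_congr ⟨fun h => ⟨h, by omega⟩, fun h => h.1⟩ rfl rfl
      · have n1 : ¬ (peakHeight l + 1 < peakHeight r) := by omega
        have n2 : ¬ (peakHeight r < peakHeight l + 1) := by omega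
        simp only [n1, n2, false_and, or_false, and_false, if_false]
        rw [if_neg, if_neg, add_zero]
        · rintro ⟨h1, h2, -⟩; omega
        · rintro ⟨⟨h1, -⟩, h2⟩; omega
      · have e : max (peakHeight l + 1) (peakHeight r) = peakHeight r := by omega
        have n1 : ¬ (peakHeight r < peakHeight l + 1) := by omega
        have n2 : ¬ ((peakHeight l = k ∧ UniquePeak l) ∧ (peakHeight r < k + 1)) := by
          rintro ⟨⟨h1, -⟩, h2⟩; omega
        simp only [e, n1, n2, hlt, true_and, false_and, false_or, if_false, zero_add]
        refine if_congr ⟨fun h => ⟨by omega, h⟩, fun h => h.2⟩ rfl rfl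
  rw [h₁, h₂] at h
  simpa [φ₁, φ₂, lowSeries, uniqueSeries] using h

open PowerSeries in
theorem uniqueSeries_succ_eq (k : ℕ) :
    uniqueSeries (k + 1) = X * lowSeries (k + 1) ^ 2 * uniqueSeries k := by
  have h1 := lowSeries_succ k
  have h2 := uniqueSeries_succ k
  linear_combination (lowSeries (k + 1)) * h2 - uniqueSeries (k + 1) * h1

open PowerSeries in
theorem uniqueSeries_mul_lowSeries (k : ℕ) :
    uniqueSeries k * lowSeries (k + 1) = lowSeries (k + 1) - lowSeries k := by
  induction k with
  | zero =>
    rw [uniqueSeries_zero, lowSeries_succ, lowSeries_zero]; simp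
  | succ k ih =>
    have h1 := lowSeries_succ k
    have h2 := lowSeries_succ (k + 1)
    rw [uniqueSeries_succ_eq]
    linear_combination X * lowSeries (k + 1) * lowSeries (k + 2) * ih
      - lowSeries (k + 1) * h2 + lowSeries (k + 2) * h1

open PowerSeries in
/-- Trees with a unique highest peak, expressed through trees of bounded height. -/
theorem uniqueSeries_succ_add (k : ℕ) :
    uniqueSeries (k + 1) + X * (uniqueSeries (k + 1) * (lowSeries (k + 2) - lowSeries k)) =
      X * (lowSeries (k + 2) - lowSeries k) := by
  linear_combination X * uniqueSeries_mul_lowSeries (k + 1) +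
    X * uniqueSeries_mul_lowSeries k + uniqueSeries_succ k

theorem peakHeight_le_numNodes (t : BinaryTree Unit) : peakHeight t ≤ t.numNodes := by
  induction t with
  | nil => simp [peakHeight]
  | node _ l r hl hr => simp only [peakHeight, numNodes]; omega

theorem coeff_lowSeries_nonneg (k n : ℕ) : 0 ≤ (lowSeries k).coeff n := by
  rw [lowSeries, coeff_treeSeries]
  exact Finset.sum_nonneg fun t _ => by split_ifs <;> simp

theorem coeff_lowSeries_mono (n : ℕ) : Monotone fun k => (lowSeries k).coeff n := by
  intro k k' hk
  simp only [lowSeries, coeff_treeSeries]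
  refine Finset.sum_le_sum fun t _ => ?_
  split_ifs
  · rfl
  · omega
  · simp
  · rfl

theorem coeff_lowSeries_of_lt {k n : ℕ} (h : n < k) : (lowSeries k).coeff n = catalan n := by
  rw [lowSeries, coeff_treeSeries, ← treesOfNumNodesEq_card_eq_catalan, Finset.card_eq_sum_ones,
    Nat.cast_sum]
  refine Finset.sum_congr rfl fun t ht => ?_
  rw [mem_treesOfNumNodesEq] at ht
  have := peakHeight_le_numNodes t
  rw [if_pos (by omega), Nat.cast_one]

theorem coeff_lowSeries_le_catalan (k n : ℕ) : (lowSeries k).coeff n ≤ catalan n := by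
  rw [← coeff_lowSeries_of_lt (show n < max k (n + 1) by omega)]
  exact coeff_lowSeries_mono n (le_max_left _ _)

theorem coeff_uniqueSeries_nonneg (k n : ℕ) : 0 ≤ (uniqueSeries k).coeff n := by
  rw [uniqueSeries, coeff_treeSeries]
  exact Finset.sum_nonneg fun t _ => by split_ifs <;> simp

theorem coeff_uniqueSeries_le (k n : ℕ) :
    (uniqueSeries k).coeff n ≤ (lowSeries (k + 1)).coeff n - (lowSeries k).coeff n := by
  simp only [uniqueSeries, lowSeries, coeff_treeSeries, ← Finset.sum_sub_distrib]
  refine Finset.sum_le_sum fun t _ => ?_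
  split_ifs <;> first | omega | norm_num

theorem coeff_uniqueSeries_of_lt {k n : ℕ} (h : n < k) : (uniqueSeries k).coeff n = 0 := by
  refine le_antisymm ?_ (coeff_uniqueSeries_nonneg k n)
  have := coeff_uniqueSeries_le k n
  rwa [coeff_lowSeries_of_lt h, coeff_lowSeries_of_lt (h.trans (Nat.lt_succ_self k)),
    sub_self] at this

theorem sum_coeff_uniqueSeries_le (N n : ℕ) :
    ∑ k ∈ Finset.range N, (uniqueSeries (k + 1)).coeff n ≤ (lowSeries (N + 1)).coeff n := by
  calc _ ≤ ∑ k ∈ Finset.range N,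
        ((lowSeries (k + 1 + 1)).coeff n - (lowSeries (k + 1)).coeff n) :=
        Finset.sum_le_sum fun k _ => coeff_uniqueSeries_le (k + 1) n
    _ = (lowSeries (N + 1)).coeff n - (lowSeries 1).coeff n :=
        Finset.sum_range_sub (fun k => (lowSeries (k + 1)).coeff n) N
    _ ≤ _ := sub_le_self _ (coeff_lowSeries_nonneg _ _)

theorem uNum_pattern132_eq_sum (n : ℕ) :
    (uNum pattern132 n : ℝ) = ∑ k ∈ Finset.range (n + 1), (uniqueSeries k).coeff n := by
  classical
  simp only [uNum_pattern132_eq_card, uniqueSeries, coeff_treeSeries]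
  rw [Finset.sum_comm, Finset.card_eq_sum_ones, Finset.sum_filter, Nat.cast_sum]
  refine Finset.sum_congr rfl fun t ht => ?_
  rw [mem_treesOfNumNodesEq] at ht
  have := peakHeight_le_numNodes t
  by_cases hU : UniquePeak t
  · simp only [hU, if_true, and_true, Nat.cast_one]
    rw [Finset.sum_ite_eq, if_pos (Finset.mem_range.mpr (by omega))]
  · simp [hU]

/-- The coefficients of the correction term in `uNum_pattern132_succ`. -/
noncomputable def correction (n : ℕ) : ℝ :=
  ∑ ij ∈ Finset.HasAntidiagonal.antidiagonal n, ∑ k ∈ Finset.range (n + 1),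
    (uniqueSeries (k + 1)).coeff ij.1 *
      ((lowSeries (k + 2)).coeff ij.2 - (lowSeries k).coeff ij.2)

theorem uNum_pattern132_succ {n : ℕ} (hn : n ≠ 0) :
    (uNum pattern132 (n + 1) : ℝ) = 2 * catalan n - correction n := by
  have h0 : (uniqueSeries 0).coeff (n + 1) = 0 := by
    rw [uniqueSeries_zero]; simp [PowerSeries.coeff_one]
  have hk : ∀ k, (uniqueSeries (k + 1)).coeff (n + 1) =
      ((lowSeries (k + 2)).coeff n - (lowSeries k).coeff n) -
        ∑ ij ∈ Finset.HasAntidiagonal.antidiagonal n, (uniqueSeries (k + 1)).coeff ij.1 *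
          ((lowSeries (k + 2)).coeff ij.2 - (lowSeries k).coeff ij.2) := by
    intro k
    have h := congrArg (PowerSeries.coeff (n + 1)) (uniqueSeries_succ_add k)
    rw [map_add, PowerSeries.coeff_succ_X_mul, PowerSeries.coeff_succ_X_mul,
      PowerSeries.coeff_mul, map_sub] at h
    simp only [map_sub] at h
    linarith
  have h1 : (lowSeries 1).coeff n = 0 := by
    rw [lowSeries_succ, lowSeries_zero]
    simp [PowerSeries.coeff_one, hn]
  have tel : ∑ k ∈ Finset.range (n + 1), ((lowSeries (k + 2)).coeff n - (lowSeries k).coeff n) =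
      2 * catalan n := by
    have e : ∀ k, (lowSeries (k + 2)).coeff n - (lowSeries k).coeff n =
        ((lowSeries (k + 1 + 1)).coeff n + (lowSeries (k + 1)).coeff n) -
          ((lowSeries (k + 1)).coeff n + (lowSeries k).coeff n) := fun k => by ring
    simp only [e]
    rw [Finset.sum_range_sub (fun k => (lowSeries (k + 1)).coeff n + (lowSeries k).coeff n),
      coeff_lowSeries_of_lt (by omega), coeff_lowSeries_of_lt (by omega), h1, lowSeries_zero]
    simp; ring
  rw [uNum_pattern132_eq_sum, Finset.sum_range_succ', h0, add_zero]
  simp only [hk]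
  rw [Finset.sum_sub_distrib, tel, Finset.sum_comm, correction]

theorem correction_nonneg (n : ℕ) : 0 ≤ correction n :=
  Finset.sum_nonneg fun _ _ => Finset.sum_nonneg fun k _ =>
    mul_nonneg (coeff_uniqueSeries_nonneg _ _)
      (sub_nonneg.mpr (coeff_lowSeries_mono _ (show k ≤ k + 2 by omega)))

theorem sum_uniqueSeries_mul_le_left (N i j : ℕ) :
    ∑ k ∈ Finset.range N, (uniqueSeries (k + 1)).coeff i *
      ((lowSeries (k + 2)).coeff j - (lowSeries k).coeff j) ≤
        catalan i * (lowSeries (i + 2)).coeff j := by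
  calc _ ≤ ∑ k ∈ Finset.range N,
        (uniqueSeries (k + 1)).coeff i * (lowSeries (i + 2)).coeff j := by
        refine Finset.sum_le_sum fun k _ => ?_
        rcases lt_or_ge i (k + 1) with h | h
        · simp [coeff_uniqueSeries_of_lt h]
        · refine mul_le_mul_of_nonneg_left ?_ (coeff_uniqueSeries_nonneg _ _)
          exact (sub_le_self _ (coeff_lowSeries_nonneg _ _)).trans
            (coeff_lowSeries_mono j (show k + 2 ≤ i + 2 by omega))
    _ ≤ _ := by
        rw [← Finset.sum_mul]
        exact mul_le_mul_of_nonneg_right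
          ((sum_coeff_uniqueSeries_le N i).trans (coeff_lowSeries_le_catalan _ _))
          (coeff_lowSeries_nonneg _ _)

theorem sum_uniqueSeries_mul_le_right (N i j : ℕ) :
    ∑ k ∈ Finset.range N, (uniqueSeries (k + 1)).coeff i *
      ((lowSeries (k + 2)).coeff j - (lowSeries k).coeff j) ≤
        catalan j * (lowSeries (j + 2)).coeff i := by
  have hle : ∀ k, (lowSeries (k + 2)).coeff j - (lowSeries k).coeff j ≤
      if k < j + 1 then (catalan j : ℝ) else 0 := by
    intro k
    split_ifs with h
    · exact (sub_le_self _ (coeff_lowSeries_nonneg _ _)).trans (coeff_lowSeries_le_catalan _ _)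
    · rw [coeff_lowSeries_of_lt (by omega), coeff_lowSeries_of_lt (by omega), sub_self]
  calc _ ≤ ∑ k ∈ Finset.range N,
        if k < j + 1 then catalan j * (uniqueSeries (k + 1)).coeff i else 0 := by
        refine Finset.sum_le_sum fun k _ => ?_
        refine (mul_le_mul_of_nonneg_left (hle k) (coeff_uniqueSeries_nonneg _ _)).trans ?_
        split_ifs
        · exact (mul_comm _ _).le
        · simp
    _ ≤ ∑ k ∈ Finset.range (j + 1), catalan j * (uniqueSeries (k + 1)).coeff i := by
        rw [← Finset.sum_filter]
        refine Finset.sum_le_sum_of_subset_of_nonneg ?_ fun k _ _ =>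
          mul_nonneg (Nat.cast_nonneg _) (coeff_uniqueSeries_nonneg _ _)
        intro k
        simp
    _ ≤ _ := by
        rw [← Finset.mul_sum]
        exact mul_le_mul_of_nonneg_left (sum_coeff_uniqueSeries_le _ i) (Nat.cast_nonneg _)

theorem correction_le (n : ℕ) :
    correction n ≤ 2 * ∑ i ∈ Finset.range (n + 1),
      if 2 * i ≤ n then catalan i * (lowSeries (i + 2)).coeff (n - i) else 0 := by
  let T : ℕ → ℕ → ℝ := fun i j => if i ≤ j then catalan i * (lowSeries (i + 2)).coeff j else 0
  have hT : ∀ i j, 0 ≤ T i j := by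
    intro i j
    simp only [T]
    split_ifs
    · exact mul_nonneg (Nat.cast_nonneg _) (coeff_lowSeries_nonneg _ _)
    · rfl
  have h1 : correction n ≤
      ∑ ij ∈ Finset.HasAntidiagonal.antidiagonal n, (T ij.1 ij.2 + T ij.2 ij.1) := by
    refine Finset.sum_le_sum fun ij _ => ?_
    rcases le_total ij.1 ij.2 with h | h
    · refine (sum_uniqueSeries_mul_le_left _ _ _).trans ?_
      have : T ij.1 ij.2 = catalan ij.1 * (lowSeries (ij.1 + 2)).coeff ij.2 := if_pos h
      rw [← this]
      exact le_add_of_nonneg_right (hT _ _)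
    · refine (sum_uniqueSeries_mul_le_right _ _ _).trans ?_
      have : T ij.2 ij.1 = catalan ij.2 * (lowSeries (ij.2 + 2)).coeff ij.1 := if_pos h
      rw [← this]
      exact le_add_of_nonneg_left (hT _ _)
  refine h1.trans_eq ?_
  rw [Finset.sum_add_distrib, ← Finset.Nat.sum_antidiagonal_swap (f := fun ij => T ij.2 ij.1)]
  simp only [Prod.fst_swap, Prod.snd_swap]
  rw [← two_mul, Finset.Nat.sum_antidiagonal_eq_sum_range_succ T]
  congr 1
  refine Finset.sum_congr rfl fun i hi => ?_
  rw [Finset.mem_range] at hi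
  exact if_congr (by omega) rfl rfl

open Filter Topology

theorem catalan_succ_mul (n : ℕ) :
    ((n : ℝ) + 2) * catalan (n + 1) = 2 * (2 * n + 1) * catalan n := by
  have h1 : ((n : ℝ) + 1) * catalan n = n.centralBinom := by
    exact_mod_cast succ_mul_catalan_eq_centralBinom n
  have h2 : ((n : ℝ) + 1 + 1) * catalan (n + 1) = (n + 1).centralBinom := by
    exact_mod_cast succ_mul_catalan_eq_centralBinom (n + 1)
  have h3 : ((n : ℝ) + 1) * (n + 1).centralBinom = 2 * (2 * n + 1) * n.centralBinom := by
    exact_mod_cast Nat.succ_mul_centralBinom_succ n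
  have h4 : (n : ℝ) + 1 ≠ 0 := by positivity
  apply mul_left_cancel₀ h4
  linear_combination ((n : ℝ) + 1) * h2 + h3 - 2 * (2 * n + 1) * h1

theorem catalan_pos (n : ℕ) : (0 : ℝ) < catalan n := by
  have h := succ_mul_catalan_eq_centralBinom n
  have h' := Nat.centralBinom_pos n
  rw [← h] at h'
  exact_mod_cast Nat.pos_of_mul_pos_left h'

theorem monotone_catalan : Monotone fun n => (catalan n : ℝ) := by
  refine monotone_nat_of_le_succ fun n => ?_
  have h := catalan_succ_mul n
  have := catalan_pos n
  have hn : (0 : ℝ) ≤ n := n.cast_nonneg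
  refine le_of_mul_le_mul_left ?_ (show (0 : ℝ) < n + 2 by positivity)
  rw [h]
  nlinarith [mul_nonneg hn this.le]

theorem tendsto_catalan_div_succ :
    Tendsto (fun n : ℕ => (catalan n : ℝ) / catalan (n + 1)) atTop (𝓝 (1 / 4)) := by
  have e : ∀ n : ℕ, (catalan n : ℝ) / catalan (n + 1) =
      1 / 4 + 3 / 8 * (1 / ((n : ℝ) + 1 / 2)) := by
    intro n
    have h := catalan_succ_mul n
    have hn : (0 : ℝ) ≤ n := n.cast_nonneg
    rw [div_eq_iff (catalan_pos _).ne']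
    field_simp
    linear_combination -16 * h
  simp only [e]
  have h : Tendsto (fun n : ℕ => 1 / ((n : ℝ) + 1 / 2)) atTop (𝓝 0) :=
    tendsto_const_nhds.div_atTop
      (tendsto_atTop_add_const_right _ _ tendsto_natCast_atTop_atTop)
  simpa only [mul_zero, add_zero] using (h.const_mul (3 / 8)).const_add (1 / 4)

theorem summable_catalan_div_four_pow : Summable fun n : ℕ => (catalan n : ℝ) / 4 ^ n := by
  let a : ℕ → ℝ := fun n => 2 * n.centralBinom / 4 ^ n
  have ha : ∀ n : ℕ, (catalan n : ℝ) / 4 ^ n = a n - a (n + 1) := by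
    intro n
    have h1 : ((n : ℝ) + 1) * catalan n = n.centralBinom := by
      exact_mod_cast succ_mul_catalan_eq_centralBinom n
    have h3 : ((n : ℝ) + 1) * (n + 1).centralBinom = 2 * (2 * n + 1) * n.centralBinom := by
      exact_mod_cast Nat.succ_mul_centralBinom_succ n
    have h4 : (n : ℝ) + 1 ≠ 0 := by positivity
    have h5 : (2 : ℝ) * catalan n = 4 * n.centralBinom - (n + 1).centralBinom := by
      apply mul_left_cancel₀ h4
      linear_combination 2 * h1 + h3
    simp only [a, pow_succ]
    field_simp
    linear_combination 2 * h5
  refine summable_of_sum_range_le (c := a 0) (fun n => by positivity) fun n => ?_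
  simp only [ha]
  rw [Finset.sum_range_sub']
  exact sub_le_self _ (by positivity)

theorem monotone_catalan_div_four_pow_mul :
    Monotone fun n : ℕ => (catalan n : ℝ) / 4 ^ n * ((n : ℝ) + 1) ^ 2 := by
  refine monotone_nat_of_le_succ fun n => ?_
  have h := catalan_succ_mul n
  have hp := catalan_pos n
  have hn : (0 : ℝ) ≤ n := n.cast_nonneg
  have e : (catalan (n + 1) : ℝ) = 2 * (2 * n + 1) * catalan n / (n + 2) := by
    rw [eq_div_iff (by positivity)]; linarith
  rw [e, pow_succ (4 : ℝ)]
  push_cast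
  have e2 : 2 * (2 * (n : ℝ) + 1) * catalan n / (n + 2) / (4 ^ n * 4) * (n + 1 + 1) ^ 2 =
      catalan n / 4 ^ n * ((2 * n + 1) * (n + 2) / 2) := by
    field_simp; ring
  rw [e2]
  refine mul_le_mul_of_nonneg_left ?_ (by positivity)
  nlinarith

theorem four_pow_le_catalan_mul (n : ℕ) : (4 : ℝ) ^ n ≤ catalan n * ((n : ℝ) + 1) ^ 2 := by
  have h := monotone_catalan_div_four_pow_mul (Nat.zero_le n)
  simp only [catalan_zero, Nat.cast_one, pow_zero, div_one, Nat.cast_zero, zero_add, one_pow,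
    mul_one] at h
  rw [div_mul_eq_mul_div, le_div_iff₀ (by positivity)] at h
  linarith

theorem catalan_sub_div_le {i n : ℕ} (h : 2 * i ≤ n) :
    (catalan (n - i) : ℝ) / catalan n ≤ 4 / 4 ^ i := by
  have hm := monotone_catalan_div_four_pow_mul (Nat.sub_le n i)
  obtain ⟨m, rfl⟩ := Nat.exists_eq_add_of_le (show i ≤ n by omega)
  simp only [Nat.add_sub_cancel_left] at hm ⊢
  have him : (i : ℝ) ≤ m := by exact_mod_cast (show i ≤ m by omega)
  have hp := catalan_pos (i + m)
  rw [div_le_div_iff₀ hp (by positivity)]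
  have h2 : (((i + m : ℕ) : ℝ) + 1) ^ 2 ≤ 4 * ((m : ℝ) + 1) ^ 2 := by
    have hi : (0 : ℝ) ≤ i := i.cast_nonneg
    push_cast
    nlinarith
  have h3 : (catalan m : ℝ) / 4 ^ m * ((m : ℝ) + 1) ^ 2 ≤
      (4 * (catalan (i + m) / 4 ^ (i + m))) * ((m : ℝ) + 1) ^ 2 := by
    refine hm.trans ?_
    calc _ ≤ (catalan (i + m) : ℝ) / 4 ^ (i + m) * (4 * ((m : ℝ) + 1) ^ 2) :=
          mul_le_mul_of_nonneg_left h2 (by positivity)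
      _ = _ := by ring
  have h4 := le_of_mul_le_mul_right h3 (by positivity)
  rw [pow_add] at h4
  field_simp at h4
  linarith

/-- The generating function of trees of bounded height converges beyond radius `1 / 4`. -/
theorem exists_sum_lowSeries_le (k : ℕ) : ∃ x : ℝ, 1 / 4 < x ∧ ∃ M : ℝ, 0 ≤ M ∧ M < 2 ∧
    ∀ N, ∑ n ∈ Finset.range N, (lowSeries k).coeff n * x ^ n ≤ M := by
  induction k with
  | zero => exact ⟨1, by norm_num, 0, le_rfl, by norm_num, by simp [lowSeries_zero]⟩
  | succ k ih =>
    obtain ⟨x, hx, M, hM0, hM, hS⟩ := ih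
    obtain ⟨y, hy, hyx, hyM⟩ : ∃ y : ℝ, 1 / 4 < y ∧ y ≤ x ∧ y * M < 1 / 2 := by
      rcases hM0.eq_or_lt with rfl | hpos
      · exact ⟨x, hx, le_rfl, by norm_num⟩
      · have h1 : 1 / 4 < min x (1 / (2 * M)) := by
          refine lt_min hx ?_
          rw [div_lt_div_iff₀ (by norm_num) (by positivity)]
          linarith
        obtain ⟨y, hy1, hy2⟩ := exists_between h1
        refine ⟨y, hy1, (hy2.trans_le (min_le_left _ _)).le, ?_⟩
        have := hy2.trans_le (min_le_right _ _)
        rw [lt_div_iff₀ (by positivity)] at this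
        linarith
    have hy0 : 0 ≤ y := by linarith
    have hyM0 : 0 ≤ y * M := mul_nonneg hy0 hM0
    refine ⟨y, hy, 1 / (1 - y * M), by apply div_nonneg <;> linarith, ?_, fun N => ?_⟩
    · rw [div_lt_iff₀ (by linarith)]; linarith
    · rw [le_div_iff₀ (by linarith)]
      let A : ℕ → ℝ := fun n => (lowSeries k).coeff n * y ^ n
      let B : ℕ → ℝ := fun n => (lowSeries (k + 1)).coeff n * y ^ n
      have hA : ∀ n, 0 ≤ A n := fun n => mul_nonneg (coeff_lowSeries_nonneg _ _) (pow_nonneg hy0 _)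
      have hB : ∀ n, 0 ≤ B n := fun n => mul_nonneg (coeff_lowSeries_nonneg _ _) (pow_nonneg hy0 _)
      have hAM : ∀ N, ∑ n ∈ Finset.range N, A n ≤ M := fun N =>
        (Finset.sum_le_sum fun n _ => mul_le_mul_of_nonneg_left (pow_le_pow_left₀ hy0 hyx n)
          (coeff_lowSeries_nonneg _ _)).trans (hS N)
      have hrec : ∀ n, B (n + 1) =
          y * ∑ ij ∈ Finset.HasAntidiagonal.antidiagonal n, A ij.1 * B ij.2 := by
        intro n
        have h := congrArg (PowerSeries.coeff (n + 1)) (lowSeries_succ k)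
        rw [map_add, PowerSeries.coeff_succ_X_mul, PowerSeries.coeff_mul,
          PowerSeries.coeff_one, if_neg (Nat.succ_ne_zero n), zero_add] at h
        simp only [B, h, Finset.mul_sum, Finset.sum_mul]
        refine Finset.sum_congr rfl fun ij hij => ?_
        rw [Finset.HasAntidiagonal.mem_antidiagonal] at hij
        simp only [A, ← hij]
        ring
      have hB0 : B 0 = 1 := by
        have h := congrArg (PowerSeries.coeff 0) (lowSeries_succ k)
        simp only [B, h]
        simp
      suffices hmain : ∑ n ∈ Finset.range N, B n ≤ 1 + y * (M * ∑ n ∈ Finset.range N, B n) by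
        simp only [B] at hmain
        linarith
      rcases N with _ | N
      · simp
      rw [Finset.sum_range_succ', hB0, add_comm]
      simp only [hrec, ← Finset.mul_sum]
      refine add_le_add le_rfl (mul_le_mul_of_nonneg_left ?_ hy0)
      calc ∑ n ∈ Finset.range N, ∑ ij ∈ Finset.HasAntidiagonal.antidiagonal n, A ij.1 * B ij.2
          ≤ ∑ i ∈ Finset.range (N + 1), ∑ j ∈ Finset.range (N + 1), A i * B j := by
            rw [← Finset.sum_product', ← Finset.sum_biUnion]
            · refine Finset.sum_le_sum_of_subset_of_nonneg ?_ fun _ _ _ => mul_nonneg (hA _) (hB _)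
              intro ij
              simp only [Finset.mem_biUnion, Finset.mem_range, Finset.HasAntidiagonal.mem_antidiagonal,
                Finset.mem_product]
              rintro ⟨n, hn, h⟩
              omega
            · intro a _ b _ hab
              exact Finset.disjoint_left.mpr fun ij h h' => hab
                ((Finset.HasAntidiagonal.mem_antidiagonal.mp h).symm.trans
                  (Finset.HasAntidiagonal.mem_antidiagonal.mp h'))
        _ = (∑ i ∈ Finset.range (N + 1), A i) * ∑ j ∈ Finset.range (N + 1), B j :=
            (Finset.sum_mul_sum ..).symm
        _ ≤ M * ∑ j ∈ Finset.range (N + 1), B j :=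
            mul_le_mul_of_nonneg_right (hAM _) (Finset.sum_nonneg fun _ _ => hB _)
        _ = _ := by rw [Finset.sum_range_succ' B, hB0]; simp only [hrec, ← Finset.mul_sum]; ring

theorem tendsto_lowSeries_div_catalan (k : ℕ) :
    Tendsto (fun n => (lowSeries k).coeff n / (catalan n : ℝ)) atTop (𝓝 0) := by
  obtain ⟨x, hx, M, hM0, hM, hS⟩ := exists_sum_lowSeries_le k
  have hx0 : 0 < x := by linarith
  have hlim : Tendsto (fun n : ℕ =>
      2 * (2 * ((n + 1 : ℕ) : ℝ) ^ 2 * (1 / (4 * x)) ^ (n + 1) * (4 * x))) atTop (𝓝 0) := by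
    have h1 : |1 / (4 * x)| < 1 := by
      rw [abs_of_pos (by positivity), div_lt_one (by positivity)]; linarith
    have h2 := (tendsto_add_atTop_iff_nat 1).mpr
      (tendsto_pow_const_mul_const_pow_of_abs_lt_one 2 h1)
    simpa [mul_assoc] using ((h2.mul_const (4 * x)).const_mul 2).const_mul 2
  refine squeeze_zero (fun n => div_nonneg (coeff_lowSeries_nonneg _ _) (Nat.cast_nonneg _))
    (fun n => ?_) hlim
  have h1 : (lowSeries k).coeff n * x ^ n ≤ 2 := by
    refine le_trans ?_ ((hS (n + 1)).trans hM.le)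
    exact Finset.single_le_sum (f := fun n => (lowSeries k).coeff n * x ^ n)
      (fun i _ => mul_nonneg (coeff_lowSeries_nonneg _ _) (pow_nonneg hx0.le _))
      (Finset.mem_range.mpr (Nat.lt_succ_self n))
  have h2 := four_pow_le_catalan_mul n
  have hp := catalan_pos n
  rw [div_le_iff₀ hp]
  have h3 : (lowSeries k).coeff n ≤ 2 / x ^ n := by
    rwa [le_div_iff₀ (by positivity)]
  refine h3.trans ?_
  have e : 2 * (2 * ((n + 1 : ℕ) : ℝ) ^ 2 * (1 / (4 * x)) ^ (n + 1) * (4 * x)) * catalan n =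
      2 / x ^ n * (2 * (catalan n * ((n : ℝ) + 1) ^ 2) / 4 ^ n) := by
    push_cast
    rw [one_div, inv_pow, mul_pow]
    field_simp
    ring
  rw [e]
  refine le_mul_of_one_le_right (by positivity) ?_
  rw [le_div_iff₀ (by positivity)]
  have : (0 : ℝ) < 4 ^ n := by positivity
  linarith

theorem tendsto_correction_div_catalan :
    Tendsto (fun n => correction n / (catalan n : ℝ)) atTop (𝓝 0) := by
  let G : ℕ → ℕ → ℝ := fun n i =>
    if 2 * i ≤ n then catalan i * (lowSeries (i + 2)).coeff (n - i) / catalan n else 0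
  have hG0 : ∀ n i, 0 ≤ G n i := by
    intro n i
    simp only [G]
    split_ifs
    · exact div_nonneg (mul_nonneg (Nat.cast_nonneg _) (coeff_lowSeries_nonneg _ _))
        (Nat.cast_nonneg _)
    · rfl
  have hGb : ∀ n i, G n i ≤ 4 * ((catalan i : ℝ) / 4 ^ i) := by
    intro n i
    simp only [G]
    split_ifs with h
    · calc _ ≤ (catalan i : ℝ) * (catalan (n - i) / catalan n) := by
            rw [mul_div_assoc]
            gcongr
            exact coeff_lowSeries_le_catalan _ _
        _ ≤ catalan i * (4 / 4 ^ i) := by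
            exact mul_le_mul_of_nonneg_left (catalan_sub_div_le h) (Nat.cast_nonneg _)
        _ = _ := by ring
    · positivity
  have hGlim : ∀ i, Tendsto (fun n => G n i) atTop (𝓝 0) := by
    intro i
    have h1 : Tendsto (fun n => (catalan i : ℝ) *
        ((lowSeries (i + 2)).coeff (n - i) / catalan (n - i))) atTop (𝓝 0) := by
      simpa using ((tendsto_lowSeries_div_catalan (i + 2)).comp
        (tendsto_sub_atTop_nat i)).const_mul (catalan i : ℝ)
    refine squeeze_zero (fun n => hG0 n i) (fun n => ?_) h1
    simp only [G]
    split_ifs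
    · rw [mul_div_assoc]
      refine mul_le_mul_of_nonneg_left ?_ (Nat.cast_nonneg _)
      exact div_le_div_of_nonneg_left (coeff_lowSeries_nonneg _ _) (catalan_pos _)
        (monotone_catalan (Nat.sub_le n i))
    · exact mul_nonneg (Nat.cast_nonneg _)
        (div_nonneg (coeff_lowSeries_nonneg _ _) (Nat.cast_nonneg _))
  have hT : Tendsto (fun n => 2 * ∑' i, G n i) atTop (𝓝 0) := by
    have h := tendsto_tsum_of_dominated_convergence (f := G) (g := fun _ => 0)
      (summable_catalan_div_four_pow.mul_left 4) hGlim
      (Eventually.of_forall fun n i => by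
        rw [Real.norm_of_nonneg (hG0 n i)]; exact hGb n i)
    simpa using h.const_mul 2
  refine squeeze_zero (fun n => div_nonneg (correction_nonneg n) (Nat.cast_nonneg _))
    (fun n => ?_) hT
  rw [tsum_eq_sum (s := Finset.range (n + 1)) (by
    intro i hi
    rw [Finset.mem_range] at hi
    exact if_neg (by omega))]
  rw [div_le_iff₀ (catalan_pos n), mul_assoc, Finset.sum_mul]
  refine (correction_le n).trans_eq ?_
  congr 1
  refine Finset.sum_congr rfl fun i _ => ?_
  simp only [G]
  split_ifs
  · rw [div_mul_cancel₀ _ (catalan_pos n).ne']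
  · simp

/-- The limit as `n → ∞` of `u_n(132)/C_n` equals `1/2`, where `C_n` is the
`n`-th Catalan number. -/
theorem lim_u132_div_catalan_eq_half :
    Filter.Tendsto (fun n : ℕ => (uNum pattern132 n : ℝ) / (catalan n : ℝ))
      Filter.atTop (nhds (1/2)) := by
  rw [← tendsto_add_atTop_iff_nat 1]
  have h : Tendsto (fun n : ℕ => 2 * ((catalan n : ℝ) / catalan (n + 1)) -
      correction n / catalan n * (catalan n / catalan (n + 1))) atTop (𝓝 (1 / 2)) := by
    have := (tendsto_catalan_div_succ.const_mul 2).sub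
      (tendsto_correction_div_catalan.mul tendsto_catalan_div_succ)
    norm_num at this ⊢
    exact this
  refine h.congr' ?_
  filter_upwards [eventually_ne_atTop 0] with n hn
  have h1 := (catalan_pos n).ne'
  have h2 := (catalan_pos (n + 1)).ne'
  rw [uNum_pattern132_succ hn]
  field_simp
end
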